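/- arXiv:1211.6872 — 7 statements merged into one kernel-verified Lean document; each statement's English description precedes it below -/
import Mathlib

section
/- Let R be a principal ideal domain and let A be an n×n matrix over R with trace zero. Then A is a commutator, i.e. there exist n×n matrices X and Y over R such that A = XY − YX. -/
open Module in
/-- A linear functional on a nonzero finite free module over a PID factors through a functional
that attains the value `1`. -/
theorem exists_functional_eq_one_of_pid {R M : Type*} [CommRing R] [IsDomain R]
    [IsPrincipalIdealRing R] [AddCommGroup M] [Module R M] {n : ℕ}
    (b : Basis (Fin (n + 1)) R M) (f : M →ₗ[R] R) :
    ∃ (f₀ : M →ₗ[R] R) (e : M), f₀ e = 1 ∧ ∀ x, f₀ x = 0 → f x = 0 := by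
  by_cases hf : f = 0
  · exact ⟨b.coord 0, b 0, by simp, by simp [hf]⟩
  obtain ⟨g, hg⟩ := IsPrincipalIdealRing.principal (LinearMap.range f)
  obtain ⟨e, he⟩ : g ∈ LinearMap.range f := hg ▸ Submodule.mem_span_singleton_self g
  have hfg (x : M) : ∃ c, c * g = f x := by
    have hx : f x ∈ LinearMap.range f := ⟨x, rfl⟩
    rwa [hg, Submodule.mem_span_singleton] at hx
  have hg0 : g ≠ 0 := by
    rintro rfl
    refine hf (LinearMap.ext fun x => ?_)
    obtain ⟨c, hc⟩ := hfg x
    simp [← hc]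
  choose c hc using hfg
  refine ⟨⟨⟨c, fun x y => mul_right_cancel₀ hg0 ?_⟩, fun r x => mul_right_cancel₀ hg0 ?_⟩, e,
    mul_right_cancel₀ hg0 ?_, fun x hx => ?_⟩
  · simp [add_mul, hc]
  · simp [mul_assoc, hc]
  · simp [hc, he]
  · have hx' : c x = 0 := hx
    rw [← hc, hx', zero_mul]

open Module in
/-- Every endomorphism of a finite free module over a PID has a basis in which its matrix is lower
Hessenberg; moreover the basis can be adapted to a given linear functional. -/
theorem exists_basis_hessenberg {R : Type*} [CommRing R] [IsDomain R] [IsPrincipalIdealRing R]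
    (n : ℕ) : ∀ {M : Type*} [AddCommGroup M] [Module R M] (_ : Basis (Fin n) R M)
    (T : M →ₗ[R] M) (f : M →ₗ[R] R), ∃ b : Basis (Fin n) R M,
      (∀ j : Fin n, (j : ℕ) ≠ 0 → f (b j) = 0) ∧
      ∀ i j : Fin n, (i : ℕ) + 1 < j → b.repr (T (b j)) i = 0 := by
  induction n with
  | zero => exact fun b _ _ => ⟨b, fun j => j.elim0, fun i => i.elim0⟩
  | succ n ih =>
    intro M _ _ b₀ T f
    obtain ⟨f₀, e, he, hf⟩ := exists_functional_eq_one_of_pid b₀ f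
    let N := LinearMap.ker f₀
    have hli : ∀ c : R, ∀ x ∈ N, c • e + x = 0 → c = 0 := by
      intro c x hx h
      have hx' : f₀ x = 0 := hx
      simpa [he, hx'] using congrArg f₀ h
    have hsp : ∀ z : M, ∃ c : R, z + c • e ∈ N := fun z =>
      ⟨-f₀ z, by simp [N, he]⟩
    obtain ⟨m, bN⟩ := Submodule.basisOfPid b₀ N
    obtain rfl : m = n := by
      have h := (Basis.mkFinCons e bN hli hsp).indexEquiv b₀
      simpa using Fintype.card_congr h
    let π : M →ₗ[R] N := LinearMap.codRestrict N (LinearMap.id - f₀.smulRight e) (by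
      intro x; simp [N, he])
    have hπ (x : M) : (π x : M) = x - f₀ x • e := rfl
    obtain ⟨b', hb', hb''⟩ := ih bN (π ∘ₗ T ∘ₗ N.subtype) (f₀ ∘ₗ T ∘ₗ N.subtype)
    have hb : ∀ j, Basis.mkFinCons e b' hli hsp j = (Fin.cons e ((↑) ∘ b') : Fin (m + 1) → M) j :=
      fun j => by rw [Basis.coe_mkFinCons]
    have hb0 : Basis.mkFinCons e b' hli hsp 0 = e := hb 0
    have hbs (j : Fin m) : Basis.mkFinCons e b' hli hsp j.succ = b' j := hb j.succ
    set b := Basis.mkFinCons e b' hli hsp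
    have hr0 : b.coord 0 = f₀ := by
      refine b.ext fun j => ?_
      refine Fin.cases ?_ (fun j => ?_) j
      · rw [hb0, he, ← hb0]
        simp
      · have h : f₀ (b' j) = 0 := (b' j).2
        rw [hbs, h, ← hbs]
        simp
    have hrs (i : Fin m) : b.coord i.succ = b'.coord i ∘ₗ π := by
      refine b.ext fun j => ?_
      refine Fin.cases ?_ (fun j => ?_) j
      · have h : π e = 0 := Subtype.ext (by rw [hπ, he]; simp)
        rw [LinearMap.comp_apply, hb0, h, ← hb0]
        simp
      · have h : π (b' j) = b' j := by
          have h0 : f₀ (b' j) = 0 := (b' j).2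
          exact Subtype.ext (by rw [hπ, h0]; simp)
        rw [LinearMap.comp_apply, hbs, h, ← hbs]
        simp [Finsupp.single_apply]
    refine ⟨b, fun j => ?_, fun i j => ?_⟩
    · refine Fin.cases (fun h => absurd rfl h) (fun j _ => ?_) j
      rw [hbs]
      exact hf _ (b' j).2
    · refine Fin.cases (fun h => by simp at h) (fun j => ?_) j
      refine Fin.cases (fun h => ?_) (fun i h => ?_) i
      · have := hb' j (by simp at h; omega)
        rw [hbs, ← Basis.coord_apply, hr0]
        exact this
      · have := hb'' i j (by simpa using h)
        rw [hbs, ← Basis.coord_apply, hrs]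
        exact this

theorem exists_bezout_factorization {R : Type*} [CommRing R] [IsDomain R]
    [IsPrincipalIdealRing R] (a b : R) :
    ∃ g a' b' x y : R, a = g * a' ∧ b = g * b' ∧ a' * x + b' * y = 1 := by
  obtain ⟨g, hg⟩ := IsPrincipalIdealRing.principal (Ideal.span {a, b})
  obtain ⟨x, y, hxy⟩ : ∃ x y, x * a + y * b = g := by
    rw [← Ideal.mem_span_pair, hg]
    exact Submodule.mem_span_singleton_self g
  obtain ⟨a', ha⟩ : ∃ a', a' * g = a := by
    have h : a ∈ Ideal.span {a, b} := Ideal.subset_span (by simp)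
    rwa [hg, Submodule.mem_span_singleton] at h
  obtain ⟨b', hb⟩ : ∃ b', b' * g = b := by
    have h : b ∈ Ideal.span {a, b} := Ideal.subset_span (by simp)
    rwa [hg, Submodule.mem_span_singleton] at h
  by_cases hg0 : g = 0
  · exact ⟨0, 1, 0, 1, 0, by simp [← ha, hg0], by simp [← hb, hg0], by simp⟩
  · refine ⟨g, a', b', x, y, by rw [← ha, mul_comm], by rw [← hb, mul_comm],
      mul_right_cancel₀ hg0 ?_⟩
    linear_combination hxy + x * ha + y * hb

open Matrix in
/-- Over a PID, every `2 × 2` matrix is trace-orthogonal to a matrix of determinant one. -/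
theorem exists_det_eq_one_trace_mul_eq_zero {R : Type*} [CommRing R] [IsDomain R]
    [IsPrincipalIdealRing R] (K : Matrix (Fin 2) (Fin 2) R) :
    ∃ M : Matrix (Fin 2) (Fin 2) R, M.det = 1 ∧ (M * K).trace = 0 := by
  let S : Set (Ideal R) := {I | ∃ U V : Matrix (Fin 2) (Fin 2) R, U.det = 1 ∧ V.det = 1 ∧
    I = Ideal.span {(U * K * V) 0 0}}
  obtain ⟨I, ⟨U, V, hU, hV, rfl⟩, hmax⟩ := set_has_maximal_iff_noetherian.mpr
    (inferInstance : IsNoetherian R R) S ⟨_, 1, 1, by simp, by simp, rfl⟩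
  have key (U' V' : Matrix (Fin 2) (Fin 2) R) (hU' : U'.det = 1) (hV' : V'.det = 1)
      (h : (U' * (U * K * V) * V') 0 0 ∣ (U * K * V) 0 0) :
      (U * K * V) 0 0 ∣ (U' * (U * K * V) * V') 0 0 := by
    have h1 : Ideal.span {(U' * (U * K * V) * V') 0 0} ∈ S :=
      ⟨U' * U, V * V', by simp [hU, hU'], by simp [hV, hV'], by simp [Matrix.mul_assoc]⟩
    have h2 := Ideal.span_singleton_le_span_singleton.mpr h
    exact Ideal.span_singleton_le_span_singleton.mp (not_lt_iff_le_imp_ge.mp (hmax _ h1) h2)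
  have hM : ∃ M : Matrix (Fin 2) (Fin 2) R, M.det = 1 ∧ (M * (U * K * V)).trace = 0 := by
    generalize U * K * V = L at key
    have hβ : L 0 0 ∣ L 0 1 := by
      obtain ⟨g, a, b, x, y, ha, hb, h⟩ := exists_bezout_factorization (L 0 0) (L 0 1)
      have hg : (1 * L * !![x, -b; y, a] : Matrix (Fin 2) (Fin 2) R) 0 0 = g := by
        simp [Matrix.mul_apply, Fin.sum_univ_two, ha, hb]
        linear_combination g * h
      have := key 1 !![x, -b; y, a] (by simp) (by simp; linear_combination h)
        (by rw [hg, ha]; exact dvd_mul_right _ _)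
      rw [hg] at this
      exact this.trans (hb ▸ dvd_mul_right _ _)
    have hγ : L 0 0 ∣ L 1 0 := by
      obtain ⟨g, a, b, x, y, ha, hb, h⟩ := exists_bezout_factorization (L 0 0) (L 1 0)
      have hg : (!![x, y; -b, a] * L * 1 : Matrix (Fin 2) (Fin 2) R) 0 0 = g := by
        simp [Matrix.mul_apply, Matrix.vecMul, dotProduct, Fin.sum_univ_two, ha, hb]
        linear_combination g * h
      have := key !![x, y; -b, a] 1 (by simp; linear_combination h) (by simp)
        (by rw [hg, ha]; exact dvd_mul_right _ _)
      rw [hg] at this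
      exact this.trans (hb ▸ dvd_mul_right _ _)
    obtain ⟨β, hβ⟩ := hβ
    obtain ⟨γ, hγ⟩ := hγ
    refine ⟨!![β - γ, 1; -1, 0], by simp, ?_⟩
    rw [Matrix.trace_fin_two, Matrix.mul_apply, Matrix.mul_apply]
    simp [Fin.sum_univ_two, hβ, hγ]
    ring
  obtain ⟨M, hM, htr⟩ := hM
  refine ⟨V * M * U, by simp [hU, hV, hM], ?_⟩
  rw [Matrix.mul_assoc, Matrix.mul_assoc, Matrix.trace_mul_comm, ← htr]
  simp [Matrix.mul_assoc]

theorem Fin.sum_ite_val_eq {M : Type*} [AddCommMonoid M] {n : ℕ} (m : ℕ) (f : Fin n → M) :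
    ∑ k : Fin n, (if (k : ℕ) = m then f k else 0) = if h : m < n then f ⟨m, h⟩ else 0 := by
  split_ifs with h
  · rw [Finset.sum_eq_single ⟨m, h⟩]
    · simp
    · intro k _ hk
      exact if_neg fun hkm => hk (Fin.ext hkm)
    · simp
  · exact Finset.sum_eq_zero fun k _ => if_neg (by omega)

/-- The lower triangular band matrix with diagonal `d`, subdiagonal `x` and second
subdiagonal `t`, all three indexed by columns. -/
def lowerBandMatrix {R : Type*} [CommRing R] (n : ℕ) (d x t : ℕ → R) : Matrix (Fin n) (Fin n) R :=
  Matrix.of fun i j => (if (i : ℕ) = j then d j else 0) + (if (i : ℕ) = j + 1 then x j else 0) +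
    (if (i : ℕ) = j + 2 then t j else 0)

theorem mul_lowerBandMatrix_apply {R : Type*} [CommRing R] {n : ℕ} (d x t : ℕ → R)
    (Y : Matrix (Fin n) (Fin n) R) (i j : Fin n) :
    (Y * lowerBandMatrix n d x t) i j = Y i j * d j +
      (if h : (j : ℕ) + 1 < n then Y i ⟨j + 1, h⟩ * x j else 0) +
      (if h : (j : ℕ) + 2 < n then Y i ⟨j + 2, h⟩ * t j else 0) := by
  simp only [Matrix.mul_apply, lowerBandMatrix, Matrix.of_apply, mul_add, mul_ite, mul_zero,
    Finset.sum_add_distrib, Fin.sum_ite_val_eq]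
  simp

/-- The action of a lower band matrix on infinite sequences. -/
def lowerBandOp {R : Type*} [CommRing R] (d x t y : ℕ → R) : ℕ → R
  | 0 => d 0 * y 0
  | 1 => d 1 * y 1 + x 0 * y 0
  | i + 2 => d (i + 2) * y (i + 2) + x (i + 1) * y (i + 1) + t i * y i

theorem lowerBandMatrix_mulVec_apply {R : Type*} [CommRing R] {n : ℕ} (d x t y : ℕ → R)
    (i : Fin n) :
    (lowerBandMatrix n d x t).mulVec (fun k => y k) i = lowerBandOp d x t y i := by
  simp only [Matrix.mulVec, dotProduct, lowerBandMatrix, Matrix.of_apply, add_mul, ite_mul,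
    zero_mul, Finset.sum_add_distrib]
  obtain ⟨i, hi⟩ := i
  have h0 (k : Fin n) : i = k ↔ (k : ℕ) = i := eq_comm
  simp only [h0, Fin.sum_ite_val_eq, hi, dif_pos]
  match i, hi with
  | 0, hi => simp [lowerBandOp]
  | 1, hi =>
    have h1 (k : Fin n) : 1 = (k : ℕ) + 1 ↔ (k : ℕ) = 0 := by omega
    have h2 (k : Fin n) : ¬ 1 = (k : ℕ) + 2 := by omega
    simp only [h1, h2, Fin.sum_ite_val_eq]
    simp [lowerBandOp, show 0 < n by omega]
  | i + 2, hi =>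
    have h1 (k : Fin n) : i + 2 = (k : ℕ) + 1 ↔ (k : ℕ) = i + 1 := by omega
    have h2 (k : Fin n) : i + 2 = (k : ℕ) + 2 ↔ (k : ℕ) = i := by omega
    simp only [h1, h2, Fin.sum_ite_val_eq]
    simp [lowerBandOp, show i + 1 < n by omega, show i < n by omega]

theorem lowerBandMatrix_mulVec_succ {R : Type*} [CommRing R] {m : ℕ} (d : ℕ → R)
    (v : Fin (m + 1) → R) (i : Fin m) :
    (lowerBandMatrix (m + 1) d 1 0).mulVec v i.succ = d (i + 1) * v i.succ + v i.castSucc := by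
  let y : ℕ → R := fun k => if h : k < m + 1 then v ⟨k, h⟩ else 0
  have hy : v = fun k : Fin (m + 1) => y k := by
    funext k
    simp only [y, k.is_lt, dif_pos, Fin.eta]
  have h1 : y (i + 1) = v i.succ := by simp [y]; rfl
  have h2 : y i = v i.castSucc := by simp [y]; rfl
  rw [← h1, ← h2, hy, lowerBandMatrix_mulVec_apply, Fin.val_succ]
  generalize (i : ℕ) = i
  cases i <;> simp [lowerBandOp]

open Matrix in
/-- A matrix trace-orthogonal to all powers of the lower bidiagonal matrix `C` with unit subdiagonal
is a commutator with `C`. -/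
theorem exists_commutator_of_trace_bidiagonal_pow {R : Type*} [CommRing R] {n : ℕ} (d : ℕ → R)
    (A : Matrix (Fin n) (Fin n) R)
    (h : ∀ r : ℕ, (lowerBandMatrix n d 1 0 ^ r * A).trace = 0) :
    ∃ Y, A = lowerBandMatrix n d 1 0 * Y - Y * lowerBandMatrix n d 1 0 := by
  obtain _ | m := n
  · exact ⟨0, Subsingleton.elim _ _⟩
  set C := lowerBandMatrix (m + 1) d 1 0 with hC
  let col : ℕ → Fin (m + 1) → R := fun j i => if h : j < m + 1 then A i ⟨j, h⟩ else 0
  let η : ℕ → Fin (m + 1) → R := fun j => Nat.rec 0 (fun j y => C *ᵥ y - d j • y - col j) j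
  have hη (j : ℕ) : η (j + 1) = C *ᵥ η j - d j • η j - col j := rfl
  let Y : Matrix (Fin (m + 1)) (Fin (m + 1)) R := Matrix.of fun i j => η j i
  have hA' (i j : Fin (m + 1)) (hj : j ≠ Fin.last m) : (A - (C * Y - Y * C)) i j = 0 := by
    have hj' : (j : ℕ) < m := Fin.val_lt_last hj
    have h1 : (C * Y) i j = (C *ᵥ η j) i := rfl
    have h2 : col j i = A i j := dif_pos j.is_lt
    rw [Matrix.sub_apply, Matrix.sub_apply, hC, mul_lowerBandMatrix_apply, ← hC, h1, ← h2]
    simp [Y, hη, hj']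
    ring
  have htr (r : ℕ) : (C ^ r * (A - (C * Y - Y * C))).trace = 0 := by
    rw [Matrix.mul_sub, Matrix.trace_sub, h, Matrix.mul_sub, Matrix.trace_sub,
      ← Matrix.mul_assoc (C ^ r) Y C, Matrix.trace_mul_comm (C ^ r * Y), ← Matrix.mul_assoc,
      ← Matrix.mul_assoc, ← pow_succ, ← pow_succ', sub_self, sub_zero]
  generalize hB : A - (C * Y - Y * C) = B at hA' htr
  have hlast (r : ℕ) : (C ^ r *ᵥ fun i => B i (Fin.last m)) (Fin.last m) = 0 := by
    rw [← htr r, Matrix.trace, Finset.sum_eq_single (Fin.last m)]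
    · rfl
    · intro j _ hj
      rw [Matrix.diag_apply, Matrix.mul_apply]
      exact Finset.sum_eq_zero fun i _ => mul_eq_zero_of_right _ (hA' i j hj)
    · simp
  have hall (i : Fin (m + 1)) : ∀ r : ℕ, (C ^ r *ᵥ fun i => B i (Fin.last m)) i = 0 := by
    induction i using Fin.reverseInduction with
    | last => exact hlast
    | cast i ih =>
      intro r
      have := ih (r + 1)
      rwa [pow_succ', ← Matrix.mulVec_mulVec, lowerBandMatrix_mulVec_succ, ih r, mul_zero,
        zero_add] at this
  refine ⟨Y, sub_eq_zero.mp (hB.trans ?_)⟩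
  ext i j
  by_cases hj : j = Fin.last m
  · simpa [hj] using hall i 0
  · exact hA' i j hj

open Matrix in
theorem exists_det_sq_smul_eq_commutator {R : Type*} [CommRing R] [IsDomain R] {n : ℕ}
    (d : ℕ → R) (X P A : Matrix (Fin n) (Fin n) R)
    (hP : X * P = P * lowerBandMatrix n d 1 0) (h : ∀ r : ℕ, (X ^ r * A).trace = 0) :
    ∃ Z, P.det ^ 2 • A = X * Z - Z * X := by
  by_cases hδ : P.det = 0
  · exact ⟨0, by simp [hδ]⟩
  set C := lowerBandMatrix n d 1 0
  have hadj : P.adjugate * X = C * P.adjugate := by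
    refine smul_right_injective _ hδ ?_
    calc P.det • (P.adjugate * X) = P.adjugate * X * (P * P.adjugate) := by
          rw [Matrix.mul_adjugate]; simp
      _ = P.adjugate * (X * P) * P.adjugate := by simp only [Matrix.mul_assoc]
      _ = P.adjugate * P * (C * P.adjugate) := by rw [hP]; simp only [Matrix.mul_assoc]
      _ = P.det • (C * P.adjugate) := by rw [Matrix.adjugate_mul]; simp
  have hpow (r : ℕ) : X ^ r * P = P * C ^ r := by
    have : SemiconjBy P C X := hP.symm
    exact (this.pow_right r).symm
  obtain ⟨Y, hY⟩ := exists_commutator_of_trace_bidiagonal_pow d (P.adjugate * A * P) fun r => by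
    calc (C ^ r * (P.adjugate * A * P)).trace = (P * (C ^ r * (P.adjugate * A))).trace := by
          rw [← Matrix.mul_assoc, Matrix.trace_mul_comm]
      _ = (X ^ r * (P * P.adjugate) * A).trace := by
          rw [← Matrix.mul_assoc, ← hpow]; simp only [Matrix.mul_assoc]
      _ = 0 := by rw [Matrix.mul_adjugate]; simp [h]
  refine ⟨P * Y * P.adjugate, ?_⟩
  calc P.det ^ 2 • A = P * P.adjugate * A * (P * P.adjugate) := by
        rw [Matrix.mul_adjugate]; simp [smul_smul, sq]
    _ = P * (P.adjugate * A * P) * P.adjugate := by simp only [Matrix.mul_assoc]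
    _ = (P * C) * Y * P.adjugate - P * Y * (C * P.adjugate) := by
        rw [hY]; simp only [Matrix.mul_assoc, Matrix.mul_sub, Matrix.sub_mul]; rfl
    _ = _ := by rw [← hP, ← hadj]; simp only [Matrix.mul_assoc]

section Parity

variable {R : Type*} [CommRing R]

/-- The sequence taking the values `a` at even and `b` at odd indices. -/
def alternating (a b : R) (k : ℕ) : R := if Even k then a else b

/-- The band matrix with alternating diagonals used to represent trace zero matrices. -/
def alternatingBand (n : ℕ) (u v l w : R) : Matrix (Fin n) (Fin n) R :=
  lowerBandMatrix n (alternating 0 l) (alternating u v) (alternating w (-w))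

theorem alternatingBand_pow_apply {n : ℕ} (u v l w : R) (r : ℕ) :
    ∃ α σ : R, ∀ i j : Fin n,
      (i < j → (alternatingBand n u v l w ^ r) i j = 0) ∧
      (i = j → (alternatingBand n u v l w ^ r) i j = α + alternating 0 l j * σ) ∧
      ((i : ℕ) = j + 1 → (alternatingBand n u v l w ^ r) i j = alternating u v j * σ) := by
  induction r with
  | zero =>
    refine ⟨1, 0, fun i j => ⟨fun h => ?_, fun h => ?_, fun h => ?_⟩⟩
    · simp [h.ne]
    · simp [h]
    · simp [show i ≠ j by rintro rfl; omega]
  | succ r ih =>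
    obtain ⟨α, σ, h⟩ := ih
    refine ⟨0, α + l * σ, fun i j => ?_⟩
    rw [pow_succ]
    generalize alternatingBand n u v l w ^ r = Q at h
    rw [alternatingBand, mul_lowerBandMatrix_apply]
    refine ⟨fun hij => ?_, fun hij => ?_, fun hij => ?_⟩
    · have h1 (hj : (j : ℕ) + 1 < n) : Q i ⟨j + 1, hj⟩ = 0 :=
        (h _ _).1 (Fin.lt_def.mpr (by simp; omega))
      have h2 (hj : (j : ℕ) + 2 < n) : Q i ⟨j + 2, hj⟩ = 0 :=
        (h _ _).1 (Fin.lt_def.mpr (by simp; omega))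
      simp [h1, h2, (h i j).1 hij]
    · have h1 (hj : (j : ℕ) + 1 < n) : Q i ⟨j + 1, hj⟩ = 0 :=
        (h _ _).1 (Fin.lt_def.mpr (by simp; omega))
      have h2 (hj : (j : ℕ) + 2 < n) : Q i ⟨j + 2, hj⟩ = 0 :=
        (h _ _).1 (Fin.lt_def.mpr (by simp; omega))
      simp only [h1, h2, (h i j).2.1 hij, zero_mul, dite_eq_ite, ite_self, add_zero]
      unfold alternating
      split_ifs <;> ring
    · have hj : (j : ℕ) + 1 < n := by omega
      have h1 : Q i ⟨j + 1, hj⟩ = α + alternating 0 l (j + 1) * σ :=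
        (h _ _).2.1 (Fin.ext (by simp [hij]))
      have h2 (hj : (j : ℕ) + 2 < n) : Q i ⟨j + 2, hj⟩ = 0 :=
        (h _ _).1 (Fin.lt_def.mpr (by simp; omega))
      simp only [hj, h1, h2, (h i j).2.2 hij, zero_mul, dite_eq_ite, ite_self, add_zero, dif_pos]
      unfold alternating
      by_cases hj : Even (j : ℕ) <;> simp [hj, Nat.even_add_one] <;> ring

theorem trace_alternatingBand_pow_mul {n : ℕ} (u v l w : R) (A : Matrix (Fin n) (Fin n) R)
    (hA : A.trace = 0) (hess : ∀ i j : Fin n, (i : ℕ) + 1 < j → A i j = 0)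
    (h : ∑ j : Fin n, (alternating 0 l j * A j j +
      alternating u v j * if h : (j : ℕ) + 1 < n then A j ⟨j + 1, h⟩ else 0) = 0) (r : ℕ) :
    (alternatingBand n u v l w ^ r * A).trace = 0 := by
  obtain ⟨α, σ, hQ⟩ := alternatingBand_pow_apply (n := n) u v l w r
  generalize alternatingBand n u v l w ^ r = Q at hQ
  have key (j : Fin n) : ∑ i, Q i j * A j i = α * A j j + σ * (alternating 0 l j * A j j +
      alternating u v j * if h : (j : ℕ) + 1 < n then A j ⟨j + 1, h⟩ else 0) := by
    have h1 (i : Fin n) : Q i j * A j i =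
        (if (i : ℕ) = j then (α + alternating 0 l j * σ) * A j i else 0) +
        (if (i : ℕ) = j + 1 then (alternating u v j * σ) * A j i else 0) := by
      rcases lt_trichotomy (i : ℕ) j with hij | hij | hij
      · simp [(hQ i j).1 hij, hij.ne, show (i : ℕ) ≠ j + 1 by omega]
      · simp [(hQ i j).2.1 (Fin.ext hij), hij]
      · by_cases hij' : (i : ℕ) = j + 1
        · simp [(hQ i j).2.2 hij', hij']
        · simp [hess j i (by omega), hij']
    simp only [h1, Finset.sum_add_distrib, Fin.sum_ite_val_eq, Fin.is_lt, dif_pos, Fin.eta]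
    split_ifs <;> ring
  calc (Q * A).trace = ∑ j, ∑ i, Q i j * A j i := by
        simp only [Matrix.trace, Matrix.diag_apply, Matrix.mul_apply]
        exact Finset.sum_comm
    _ = α * A.trace + σ * 0 := by
        rw [← h, Finset.sum_congr rfl fun j _ => key j, Finset.sum_add_distrib,
          ← Finset.mul_sum, ← Finset.mul_sum]
        rfl
    _ = 0 := by simp [hA]

/-- The columns of a triangular matrix conjugating the alternating band matrix to a
bidiagonal one. -/
def bandColumn (u v l w β : R) : ℕ → ℕ → R
  | 0 => fun k => if k = 0 then 1 else if k = 1 then β else 0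
  | j + 1 => fun k => lowerBandOp (alternating 0 l) (alternating u v) (alternating w (-w))
      (bandColumn u v l w β j) k - alternating 0 l j * bandColumn u v l w β j k

theorem bandColumn_apply (u v l w β : R) (huv : u * v - l * w = 1) (j : ℕ) :
    (∀ i < j, bandColumn u v l w β j i = 0) ∧
    bandColumn u v l w β j j = alternating 1 (u + l * β) j ∧
    bandColumn u v l w β j (j + 1) = alternating β (w + v * β) j := by
  induction j with
  | zero => simp [bandColumn, alternating]
  | succ j ih =>
    obtain ⟨h0, h1, h2⟩ := ih
    have hcol (k : ℕ) : bandColumn u v l w β (j + 1) k =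
      lowerBandOp (alternating 0 l) (alternating u v) (alternating w (-w))
        (bandColumn u v l w β j) k - alternating 0 l j * bandColumn u v l w β j k := rfl
    have hop0 (y : ℕ → R) (i : ℕ) (hy : ∀ k < i, y k = 0) :
        lowerBandOp (alternating 0 l) (alternating u v) (alternating w (-w)) y i =
          alternating 0 l i * y i := by
      match i, hy with
      | 0, hy => rfl
      | 1, hy => simp [lowerBandOp, hy]
      | i + 2, hy => simp [lowerBandOp, hy]
    have hop1 (y : ℕ → R) (i : ℕ) (hy : ∀ k < i, y k = 0) :
        lowerBandOp (alternating 0 l) (alternating u v) (alternating w (-w)) y (i + 1) =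
          alternating 0 l (i + 1) * y (i + 1) + alternating u v i * y i := by
      match i, hy with
      | 0, hy => rfl
      | i + 1, hy => simp [lowerBandOp, hy]
    refine ⟨fun i hi => ?_, ?_, ?_⟩
    · rw [hcol, hop0 _ i fun k hk => h0 k (by omega)]
      obtain hi | rfl := Nat.lt_succ_iff_lt_or_eq.mp hi
      · simp [h0 i hi]
      · ring
    · rw [hcol, hop1 _ j h0, h1, h2]
      by_cases hj : Even j <;> simp [alternating, hj, Nat.even_add_one]
      · ring
      · linear_combination huv
    · rw [hcol, lowerBandOp, h1, h2]
      by_cases hj : Even j <;> simp [alternating, hj, Nat.even_add_one]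
      · ring
      · linear_combination β * huv

/-- The triangular matrix with columns `bandColumn`. -/
def bandConjugator (n : ℕ) (u v l w β : R) : Matrix (Fin n) (Fin n) R :=
  Matrix.of fun i j => bandColumn u v l w β j i

theorem alternatingBand_mul_bandConjugator (n : ℕ) (u v l w β : R) (huv : u * v - l * w = 1) :
    alternatingBand n u v l w * bandConjugator n u v l w β =
      bandConjugator n u v l w β * lowerBandMatrix n (alternating 0 l) 1 0 := by
  ext i j
  rw [mul_lowerBandMatrix_apply]
  have h1 : (alternatingBand n u v l w * bandConjugator n u v l w β) i j =
      lowerBandOp (alternating 0 l) (alternating u v) (alternating w (-w))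
        (bandColumn u v l w β j) i :=
    lowerBandMatrix_mulVec_apply _ _ _ _ i
  have h2 : bandColumn u v l w β (j + 1) i = lowerBandOp (alternating 0 l) (alternating u v)
      (alternating w (-w)) (bandColumn u v l w β j) i -
        alternating 0 l j * bandColumn u v l w β j i := rfl
  have h3 : (if h : (j : ℕ) + 1 < n then bandConjugator n u v l w β i ⟨j + 1, h⟩ *
      (1 : ℕ → R) j else 0) = bandColumn u v l w β (j + 1) i := by
    split_ifs with h
    · simp [bandConjugator]
    · exact ((bandColumn_apply u v l w β huv (j + 1)).1 i (by omega)).symm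
  rw [h1, h3, h2]
  simp [bandConjugator]
  ring

theorem det_bandConjugator (n : ℕ) (u v l w β : R) (huv : u * v - l * w = 1) :
    (bandConjugator n u v l w β).det = ∏ i : Fin n, alternating 1 (u + l * β) i := by
  rw [Matrix.det_of_isLowerTriangular]
  · exact Finset.prod_congr rfl fun i _ => (bandColumn_apply u v l w β huv i).2.1
  · intro i j hij
    exact (bandColumn_apply u v l w β huv j).1 i hij

theorem isCoprime_det_bandConjugator (n : ℕ) (u v l w : R) (huv : u * v - l * w = 1) :
    IsCoprime (bandConjugator n u v l w 0).det (bandConjugator n u v l w 1).det := by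
  rw [det_bandConjugator _ _ _ _ _ _ huv, det_bandConjugator _ _ _ _ _ _ huv]
  refine IsCoprime.prod_left fun i _ => IsCoprime.prod_right fun j _ => ?_
  have h : IsCoprime u (u + l) := ⟨v + w, -w, by linear_combination huv⟩
  unfold alternating
  split_ifs <;> simp [h, isCoprime_one_left, isCoprime_one_right]

end Parity

/-- A trace zero lower Hessenberg matrix over a PID is a commutator. -/
theorem exists_commutator_of_hessenberg {R : Type*} [CommRing R] [IsDomain R]
    [IsPrincipalIdealRing R] {n : ℕ} (A : Matrix (Fin n) (Fin n) R) (hA : A.trace = 0)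
    (hess : ∀ i j : Fin n, (i : ℕ) + 1 < j → A i j = 0) :
    ∃ X Y : Matrix (Fin n) (Fin n) R, A = X * Y - Y * X := by
  let s : Fin n → R := fun j => if h : (j : ℕ) + 1 < n then A j ⟨j + 1, h⟩ else 0
  obtain ⟨M, hdet, htr⟩ := exists_det_eq_one_trace_mul_eq_zero
    !![∑ j : Fin n, alternating 1 0 j * s j, 0;
      ∑ j : Fin n, alternating 0 1 j * A j j, ∑ j : Fin n, alternating 0 1 j * s j]
  have huv : M 0 0 * M 1 1 - M 0 1 * M 1 0 = 1 := by rw [← hdet, Matrix.det_fin_two]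
  set X := alternatingBand n (M 0 0) (M 1 1) (M 0 1) (M 1 0)
  have hX (r : ℕ) : (X ^ r * A).trace = 0 := by
    refine trace_alternatingBand_pow_mul _ _ _ _ A hA hess ?_ r
    have h1 (j : Fin n) : alternating 0 (M 0 1) j * A j j + alternating (M 0 0) (M 1 1) j * s j =
        M 0 0 * (alternating 1 0 j * s j) + M 0 1 * (alternating 0 1 j * A j j) +
          M 1 1 * (alternating 0 1 j * s j) := by
      unfold alternating
      split_ifs <;> ring
    rw [Finset.sum_congr rfl fun j _ => h1 j]
    rw [Matrix.trace_fin_two, Matrix.mul_apply, Matrix.mul_apply] at htr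
    simpa [Fin.sum_univ_two, Finset.sum_add_distrib, Finset.mul_sum] using htr
  obtain ⟨Z₀, hZ₀⟩ := exists_det_sq_smul_eq_commutator _ X _ A
    (alternatingBand_mul_bandConjugator n _ _ _ _ 0 huv) hX
  obtain ⟨Z₁, hZ₁⟩ := exists_det_sq_smul_eq_commutator _ X _ A
    (alternatingBand_mul_bandConjugator n _ _ _ _ 1 huv) hX
  obtain ⟨a, b, hab⟩ := (isCoprime_det_bandConjugator n _ _ _ _ huv).pow (m := 2) (n := 2)
  refine ⟨X, a • Z₀ + b • Z₁, ?_⟩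
  rw [← one_smul R A, ← hab, add_smul, mul_smul, mul_smul, hZ₀, hZ₁]
  simp only [smul_sub, mul_add, add_mul, Matrix.mul_smul, Matrix.smul_mul]
  abel

/-- **Theorem (Stasinski, Thm 1.1 / Main Theorem).**
Let `R` be a principal ideal domain and `A` an `n × n` matrix over `R` with trace zero.
Then `A` is a commutator: `A = X * Y - Y * X` for some `X Y`. -/
theorem trace_zero_is_commutator_of_pid {R : Type*} [CommRing R] [IsDomain R]
    [IsPrincipalIdealRing R] {n : ℕ} (A : Matrix (Fin n) (Fin n) R)
    (hA : Matrix.trace A = 0) :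
    ∃ X Y : Matrix (Fin n) (Fin n) R, A = X * Y - Y * X := by
  let ψ := LinearMap.toMatrixAlgEquiv (Pi.basisFun R (Fin n))
  obtain ⟨b, -, hb⟩ := exists_basis_hessenberg n (Pi.basisFun R (Fin n)) (ψ.symm A) 0
  let φ := LinearMap.toMatrixAlgEquiv b
  obtain ⟨X, Y, h⟩ := exists_commutator_of_hessenberg (φ (ψ.symm A))
    (by
      rw [← hA, ← ψ.apply_symm_apply A, ψ.symm_apply_apply]
      exact (LinearMap.trace_eq_matrix_trace R b _).symm.trans
        (LinearMap.trace_eq_matrix_trace R (Pi.basisFun R (Fin n)) _))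
    fun i j hij => by
      rw [LinearMap.toMatrixAlgEquiv_apply]
      exact hb i j hij
  refine ⟨ψ (φ.symm X), ψ (φ.symm Y), ?_⟩
  simp only [← map_mul, ← map_sub, ← h]
  simp
end

section
/- Let R be a commutative principal ideal ring (not necessarily an integral domain) and let A be an n×n matrix over R with n ≥ 2 and trace zero. Then A = XY − YX for some n×n matrices X and Y over R. -/
open Matrix

/-- A principal ideal ring has stable range at most two. -/
theorem exists_isCoprime_add_mul_of_pir {R : Type*} [CommRing R] [IsPrincipalIdealRing R]
    {a b m : R} (h : ∃ u v w : R, u * a + v * b + w * m = 1) :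
    ∃ α β : R, IsCoprime (a + m * α) (b + m * β) := by
  let F : R × R → Ideal R := fun p => Ideal.span {a + m * p.1, b + m * p.2}
  obtain ⟨I, ⟨p, rfl⟩, hmax⟩ := set_has_maximal_iff_noetherian.mpr
    (inferInstance : IsNoetherian R R) (Set.range F) ⟨_, ⟨0, rfl⟩⟩
  refine ⟨p.1, p.2, ?_⟩
  have hmax' : ∀ α β : R, F p ≤ F (α, β) → F (α, β) ≤ F p := fun α β hle => by
    by_contra hn
    exact hmax _ ⟨(α, β), rfl⟩ (lt_of_le_not_ge hle hn)
  obtain ⟨f, hf⟩ := (IsPrincipalIdealRing.principal (F p)).principal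
  replace hf : F p = Ideal.span {f} := hf
  have ha : a + m * p.1 ∈ F p := Ideal.subset_span (by simp)
  have hb : b + m * p.2 ∈ F p := Ideal.subset_span (by simp)
  have hff : f ∈ F p := hf ▸ Ideal.mem_span_singleton_self f
  obtain ⟨u₀, v₀, w₀, h₀⟩ := h
  obtain ⟨u, v, w, h⟩ : ∃ u v w : R, u * (a + m * p.1) + v * (b + m * p.2) + w * m = 1 :=
    ⟨u₀, v₀, w₀ - u₀ * p.1 - v₀ * p.2, by linear_combination h₀⟩
  obtain ⟨x, y, hxy⟩ := Ideal.mem_span_pair.mp hff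
  obtain ⟨a₁, ha₁⟩ := Ideal.mem_span_singleton.mp (hf ▸ ha)
  obtain ⟨b₁, hb₁⟩ := Ideal.mem_span_singleton.mp (hf ▸ hb)
  have hle : ∀ J : Ideal R, f ∈ J → F p ≤ J := fun J hJ => by
    rw [hf, Ideal.span_singleton_le_iff_mem]; exact hJ
  have h1 := hmax' (p.1 - y) (p.2 + x) (hle _ (Ideal.mem_span_pair.mpr
    ⟨x, y, by linear_combination hxy⟩))
  have hmy : m * y ∈ F p := by
    have := (F p).sub_mem ha (h1 (Ideal.subset_span (Set.mem_insert _ _)))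
    convert this using 1; ring
  have hmx : m * x ∈ F p := by
    have := (F p).sub_mem (h1 (Ideal.subset_span (Set.mem_insert_of_mem _ rfl))) hb
    convert this using 1; ring
  obtain ⟨x₁, hx₁⟩ := Ideal.mem_span_singleton.mp (hf ▸ hmx)
  obtain ⟨y₁, hy₁⟩ := Ideal.mem_span_singleton.mp (hf ▸ hmy)
  obtain ⟨z, hz⟩ : ∃ z, f = f * f * z := by
    refine ⟨a₁ * (u * a₁ * x + v * b₁ * x + w * x₁) + b₁ * (u * a₁ * y + v * b₁ * y + w * y₁), ?_⟩
    have hx : x = f * (u * a₁ * x + v * b₁ * x + w * x₁) := by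
      linear_combination (-x) * h + u * x * ha₁ + v * x * hb₁ + w * hx₁
    have hy : y = f * (u * a₁ * y + v * b₁ * y + w * y₁) := by
      linear_combination (-y) * h + u * y * ha₁ + v * y * hb₁ + w * hy₁
    linear_combination (-1 : R) * hxy + x * ha₁ + y * hb₁ + f * a₁ * hx + f * b₁ * hy
  have h2 := hmax' (p.1 + (1 - f * z)) p.2 (by
    refine Ideal.span_le.mpr ?_
    have hb' : b + m * p.2 ∈ F (p.1 + (1 - f * z), p.2) :=
      Ideal.subset_span (Set.mem_insert_of_mem _ rfl)
    rintro t (rfl | rfl)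
    · have := Ideal.mul_mem_left _ (f * z)
        (Ideal.subset_span (Set.mem_insert _ _) :
          a + m * (p.1 + (1 - f * z)) ∈ F (p.1 + (1 - f * z), p.2))
      suffices h : a + m * p.1 = f * z * (a + m * (p.1 + (1 - f * z))) by
        rw [h]; exact this
      linear_combination (1 - f * z) * ha₁ + (a₁ - m * z) * hz
    · exact hb')
  have hmε : m * (1 - f * z) ∈ F p := by
    have := (F p).sub_mem (h2 (Ideal.subset_span (Set.mem_insert _ _))) ha
    convert this using 1; ring
  obtain ⟨q, hq⟩ := Ideal.mem_span_singleton.mp (hf ▸ hmε)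
  have hm0 : m * (1 - f * z) = 0 := by
    linear_combination (1 - f * z) * hq + (q + m * z) * hz
  have hunit : f * z = 1 := by
    linear_combination (1 - f * z) * h - u * (1 - f * z) * ha₁ - v * (1 - f * z) * hb₁
      - w * hm0 - (u * a₁ + v * b₁) * hz
  exact ⟨z * x, z * y, by linear_combination z * hxy + hunit⟩

/-- A principal ideal ring is a Hermite ring: two elements have a common factor with coprime
cofactors. -/
theorem exists_eq_mul_isCoprime_of_pir {R : Type*} [CommRing R] [IsPrincipalIdealRing R]
    (a b : R) : ∃ d a' b' : R, a = d * a' ∧ b = d * b' ∧ IsCoprime a' b' := by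
  obtain ⟨d, hd⟩ := (IsPrincipalIdealRing.principal (Ideal.span {a, b})).principal
  replace hd : Ideal.span {a, b} = Ideal.span {d} := hd
  obtain ⟨a', ha⟩ := Ideal.mem_span_singleton.mp
    (hd ▸ Ideal.subset_span (by simp) : a ∈ Ideal.span {d})
  obtain ⟨b', hb⟩ := Ideal.mem_span_singleton.mp
    (hd ▸ Ideal.subset_span (by simp) : b ∈ Ideal.span {d})
  obtain ⟨x, y, hxy⟩ := Ideal.mem_span_pair.mp
    (hd ▸ Ideal.mem_span_singleton_self d : d ∈ Ideal.span {a, b})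
  obtain ⟨α, β, h⟩ := exists_isCoprime_add_mul_of_pir
    (a := a') (b := b') (m := 1 - x * a' - y * b') ⟨x, y, 1, by ring⟩
  have he : d * (1 - x * a' - y * b') = 0 := by linear_combination (-1 : R) * hxy + x * ha + y * hb
  exact ⟨d, _, _, by linear_combination ha - α * he, by linear_combination hb - β * he, h⟩

/-- Row reduction over a principal ideal ring: an invertible matrix clears the entries of `w`
indexed by `s`, using only the coordinates in `insert i₀ s`. -/
theorem exists_mulVec_eq_zero_of_pir {R : Type*} [CommRing R] [IsPrincipalIdealRing R]
    {ι : Type*} [Fintype ι] [DecidableEq ι] (i₀ : ι) (w : ι → R) (s : Finset ι) (hs : i₀ ∉ s) :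
    ∃ U V : Matrix ι ι R, U * V = 1 ∧ (∀ j ∈ s, (U *ᵥ w) j = 0) ∧
      ∀ k ∉ s, k ≠ i₀ → ∀ i, U i k = (1 : Matrix ι ι R) i k := by
  induction s using Finset.induction_on with
  | empty => exact ⟨1, 1, by simp, by simp, by simp⟩
  | insert j s hj ih =>
    simp only [Finset.mem_insert, not_or] at hs
    obtain ⟨U, V, hUV, hU, hk⟩ := ih hs.2
    obtain ⟨d, a, b, ha, hb, x, y, hxy⟩ :=
      exists_eq_mul_isCoprime_of_pir ((U *ᵥ w) i₀) ((U *ᵥ w) j)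
    have hne := hs.1
    let T : R → R → R → R → Matrix ι ι R := fun p q r t =>
      Matrix.of fun i => if i = i₀ then p • Pi.single i₀ 1 + q • Pi.single j 1
        else if i = j then r • Pi.single i₀ 1 + t • Pi.single j 1 else Pi.single i 1
    have hT : ∀ p q r t v i, (T p q r t *ᵥ v) i = if i = i₀ then p * v i₀ + q * v j
        else if i = j then r * v i₀ + t * v j else v i := by
      intro p q r t v i
      simp only [T, Matrix.mulVec, Matrix.of_apply]
      split_ifs <;>
        simp only [add_dotProduct, smul_dotProduct, single_dotProduct, one_mul, smul_eq_mul]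
    have hTT : T x y (-b) a * T a (-y) b x = 1 := by
      apply Matrix.mulVec_injective
      funext v i
      rw [← Matrix.mulVec_mulVec, Matrix.one_mulVec]
      simp only [hT]
      split_ifs with h1 h2 h3 <;> simp_all
      · linear_combination v i₀ * hxy
      · linear_combination v j * hxy
    refine ⟨T x y (-b) a * U, V * T a (-y) b x, ?_, ?_, ?_⟩
    · calc _ = T x y (-b) a * (U * V) * T a (-y) b x := by simp only [Matrix.mul_assoc]
        _ = 1 := by rw [hUV, Matrix.mul_one, hTT]
    · intro i hi
      rw [← Matrix.mulVec_mulVec, hT]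
      rw [Finset.mem_insert] at hi
      rcases hi with rfl | hi
      · rw [if_neg (Ne.symm hne), if_pos rfl, ha, hb]; ring
      · rw [if_neg (by rintro rfl; exact hs.2 hi), if_neg (by rintro rfl; exact hj hi), hU i hi]
    · intro k hks hk0 i
      simp only [Finset.mem_insert, not_or] at hks
      have hcol : U *ᵥ Pi.single k 1 = Pi.single k 1 := by
        ext l; simp [hk k hks.2 hk0 l, Matrix.one_apply, Pi.single_apply]
      have : (T x y (-b) a * U) *ᵥ Pi.single k 1 = Pi.single k 1 := by
        rw [← Matrix.mulVec_mulVec, hcol]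
        ext l
        rw [hT]
        have h1 := hks.1
        split_ifs <;> simp_all [Pi.single_apply, eq_comm]
      have := congrFun this i
      simpa [Matrix.one_apply, Pi.single_apply] using this

/-- The ideal generated by the entries of the `i₀`-th column of `B` off the diagonal. -/
def Matrix.offDiagColIdeal {R ι : Type*} [CommRing R] (B : Matrix ι ι R) (i₀ : ι) : Ideal R :=
  Ideal.span ((fun i => B i i₀) '' {i | i ≠ i₀})

theorem minor_mem_offDiagColIdeal {R ι : Type*} [CommRing R] [Fintype ι] [DecidableEq ι]
    (B U V : Matrix ι ι R) (hUV : U * V = 1) (i₀ i k : ι) :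
    V i i₀ * (B * V) k i₀ - V k i₀ * (B * V) i i₀ ∈ (U * B * V).offDiagColIdeal i₀ := by
  have hVU : V * U = 1 := mul_eq_one_comm.mp hUV
  have hBV : B * V = V * (U * B * V) := by
    simp only [← Matrix.mul_assoc, hVU, Matrix.one_mul]
  have key : ∀ l, (B * V) l i₀ - V l i₀ * (U * B * V) i₀ i₀ ∈ (U * B * V).offDiagColIdeal i₀ := by
    intro l
    rw [hBV, Matrix.mul_apply, ← Finset.sum_erase_add _ _ (Finset.mem_univ i₀),
      add_sub_cancel_right]
    refine Ideal.sum_mem _ fun j hj => Ideal.mul_mem_left _ _ (Ideal.subset_span ?_)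
    exact ⟨j, (Finset.mem_erase.mp hj).1, rfl⟩
  have := Ideal.sub_mem _ (Ideal.mul_mem_left _ (V i i₀) (key k))
    (Ideal.mul_mem_left _ (V k i₀) (key i))
  convert this using 1
  ring

/-- Every vector is a multiple of a column of an invertible matrix. -/
theorem exists_eq_smul_col_of_pir {R : Type*} [CommRing R] [IsPrincipalIdealRing R]
    {ι : Type*} [Fintype ι] [DecidableEq ι] (i₀ : ι) (w : ι → R) :
    ∃ (U V : Matrix ι ι R) (d : R), U * V = 1 ∧ ∀ i, w i = d * V i i₀ := by
  obtain ⟨U, V, hUV, hU, -⟩ := exists_mulVec_eq_zero_of_pir i₀ w (Finset.univ.erase i₀) (by simp)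
  refine ⟨U, V, (U *ᵥ w) i₀, hUV, fun i => ?_⟩
  have h : U *ᵥ w = Pi.single i₀ ((U *ᵥ w) i₀) := by
    ext j
    by_cases hj : j = i₀
    · subst hj; simp
    · rw [hU j (by simp [hj]), Pi.single_eq_of_ne hj]
  have h2 : V *ᵥ (U *ᵥ w) = w := by
    rw [Matrix.mulVec_mulVec, mul_eq_one_comm.mp hUV, Matrix.one_mulVec]
  rw [h] at h2
  have := congrFun h2 i
  simp at this
  rw [← this]; ring

/-- If `s` divides all minors of `(v, C v)` as soon as it lies in the ideal they generate (up to
enlarging it to some `J`), then `C` maps `e_j + κ e_{i₁}` into every maximal ideal containing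
`s`. -/
theorem mulVec_mem_of_minors {R : Type*} [CommRing R] [IsPrincipalIdealRing R]
    {ι : Type*} [Fintype ι] [DecidableEq ι] {i₀ i₁ j : ι} (h01 : i₀ ≠ i₁) (h0j : i₀ ≠ j)
    (h1j : i₁ ≠ j) (C : Matrix ι ι R) (s : R) (hC : ∀ i, C i i₀ = if i = i₁ then s else 0)
    (hmin : ∀ v : ι → R, ∃ J : Ideal R, (∀ i k, v i * (C *ᵥ v) k - v k * (C *ᵥ v) i ∈ J) ∧
      (s ∈ J → J ≤ Ideal.span {s}))
    (M : Ideal R) [M.IsMaximal] (hs : s ∈ M) (κ : R) (i : ι) :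
    (C *ᵥ (Pi.single j 1 + κ • Pi.single i₁ 1)) i ∈ M := by
  set y : ι → R := Pi.single j 1 + κ • Pi.single i₁ 1 with hy
  set z := C *ᵥ y with hz
  have hsM : Ideal.span {s} ≤ M := (Ideal.span_singleton_le_iff_mem _).mpr hs
  have hv : ∀ x t i, (x • (Pi.single i₀ 1 : ι → R) + t • y) i =
      if i = i₀ then x else if i = i₁ then t * κ else if i = j then t else 0 := by
    intro x t i
    split_ifs <;> subst_vars <;> simp [*]
  have hCv : ∀ x t i, (C *ᵥ (x • (Pi.single i₀ 1 : ι → R) + t • y)) i =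
      (if i = i₁ then x * s else 0) + t * z i := by
    intro x t i
    rw [Matrix.mulVec_add, Matrix.mulVec_smul, Matrix.mulVec_smul, ← hz]
    simp [hC]
  have hmin' : ∀ x t : R, ∃ J : Ideal R, (s ∈ J → J ≤ Ideal.span {s}) ∧
      x * (x * s + t * z i₁) - t * κ * (t * z i₀) ∈ J ∧
      x * (t * z j) - t * (t * z i₀) ∈ J ∧
      t * (x * s + t * z i₁) - t * κ * (t * z j) ∈ J ∧
      ∀ i, i ≠ i₀ → i ≠ i₁ → i ≠ j → t * (t * z i) ∈ J := by
    intro x t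
    obtain ⟨J, hJ, hJs⟩ := hmin (x • (Pi.single i₀ 1 : ι → R) + t • y)
    simp only [hv, hCv] at hJ
    refine ⟨J, hJs, ?_, ?_, ?_, fun i hi0 hi1 hij => ?_⟩
    · simpa [h01, h01.symm] using hJ i₀ i₁
    · simpa [h01, h01.symm, h0j, h0j.symm, h1j, h1j.symm] using hJ i₀ j
    · simpa [h01, h01.symm, h0j, h0j.symm, h1j, h1j.symm] using hJ j i₁
    · simpa [h01, h01.symm, h0j, h0j.symm, h1j, h1j.symm, hi0, hi1, hij] using hJ j i
  obtain ⟨r, hr⟩ : ∃ r, z i₁ - κ * z j = s * r := by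
    obtain ⟨h, s', r', hs', hr', x, t, hxt⟩ :=
      exists_eq_mul_isCoprime_of_pir s (z i₁ - κ * z j)
    obtain ⟨J, hJs, h1, h2, h3, -⟩ := hmin' x t
    have hxh : x * h ∈ J := by
      have := J.sub_mem h1 (J.mul_mem_left κ h2)
      convert this using 1
      linear_combination (-x * h) * hxt - x * x * hs' - x * t * hr'
    have hth : t * h ∈ J := by
      convert h3 using 1
      linear_combination (-t * h) * hxt - t * x * hs' - t * t * hr'
    have hh : h ∈ J := by
      have := J.add_mem (J.mul_mem_left s' hxh) (J.mul_mem_left r' hth)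
      convert this using 1
      linear_combination (-h) * hxt
    have hsJ : s ∈ J := hs' ▸ J.mul_mem_right s' hh
    obtain ⟨q, hq⟩ := Ideal.mem_span_singleton.mp (hJs hsJ hh)
    exact ⟨q * r', by rw [hr', hq]; ring⟩
  have hs_mem : ∀ (x : R) (J : Ideal R),
      (x - r) * z j - z i₀ ∈ J →
      (x - r) * s + z i₁ - κ * z j ∈ J → x * s ∈ J ∧ x * z j - (z i₀ + r * z j) ∈ J := by
    intro x J h2 h3
    constructor
    · convert h3 using 1
      linear_combination -hr
    · convert h2 using 1
      ring
  have hdiff : z j - (z i₀ + r * z j) ∈ M ∧ ∀ i, i ≠ i₀ → i ≠ i₁ → i ≠ j → z i ∈ M := by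
    obtain ⟨J, hJs, -, h2, h3, h4⟩ := hmin' (1 - r) 1
    simp only [one_mul] at h2 h3 h4
    obtain ⟨h5, h6⟩ := hs_mem 1 J h2 h3
    rw [one_mul] at h5 h6
    exact ⟨hsM (hJs h5 h6), fun i a b c => hsM (hJs h5 (h4 i a b c))⟩
  have hβ : z i₀ + r * z j ∈ M := by
    by_contra hβ
    obtain ⟨l, hl⟩ := Ideal.IsMaximal.exists_inv ‹M.IsMaximal› hβ
    obtain ⟨x, hx, hxl⟩ := hl
    obtain ⟨J, hJs, -, h2, h3, -⟩ := hmin' (x - r) 1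
    simp only [one_mul] at h2 h3
    obtain ⟨h5, h6⟩ := hs_mem x J h2 h3
    have hsJ : s ∈ J := by
      have := J.add_mem (J.mul_mem_left (1 + l * z j) h5) (J.mul_mem_left (-(l * s)) h6)
      convert this using 1
      linear_combination (-s) * hxl
    have := M.sub_mem (M.mul_mem_right (z j) hx) (hsM (hJs hsJ h6))
    rw [sub_sub_cancel] at this
    exact hβ this
  have hzj : z j ∈ M := by simpa using M.add_mem hdiff.1 hβ
  by_cases hi0 : i = i₀
  · subst hi0
    simpa using M.sub_mem hβ (M.mul_mem_left r hzj)
  by_cases hi1 : i = i₁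
  · subst hi1
    rw [sub_eq_iff_eq_add.mp hr]
    exact M.add_mem (M.mul_mem_right _ hs) (M.mul_mem_left _ hzj)
  by_cases hij : i = j
  · exact hij ▸ hzj
  exact hdiff.2 i hi0 hi1 hij

/-- A matrix which is not scalar modulo any maximal ideal is similar to a matrix having a `1` as
its only off-diagonal entry in the column `i₀`. -/
theorem exists_conj_col_eq_single_of_pir {R : Type*} [CommRing R] [IsPrincipalIdealRing R]
    {ι : Type*} [Fintype ι] [DecidableEq ι] {i₀ i₁ i₂ : ι} (h01 : i₀ ≠ i₁) (h02 : i₀ ≠ i₂)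
    (h12 : i₁ ≠ i₂) (B : Matrix ι ι R)
    (hB : ∀ M : Ideal R, M.IsMaximal → ∀ α : R, ∃ i j, (B - α • (1 : Matrix ι ι R)) i j ∉ M) :
    ∃ U V : Matrix ι ι R, U * V = 1 ∧ (U * B * V) i₁ i₀ = 1 ∧
      ∀ i, i ≠ i₀ → i ≠ i₁ → (U * B * V) i i₀ = 0 := by
  let S : Set (Ideal R) :=
    {I | ∃ U V : Matrix ι ι R, U * V = 1 ∧ (U * B * V).offDiagColIdeal i₀ = I}
  obtain ⟨I, ⟨U₀, V₀, hUV₀, rfl⟩, hmax⟩ := set_has_maximal_iff_noetherian.mpr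
    (inferInstance : IsNoetherian R R) S ⟨_, 1, 1, Matrix.one_mul 1, rfl⟩
  set B₀ := U₀ * B * V₀ with hB₀
  obtain ⟨U₁, V₁, hUV₁, hU₁, hU₁'⟩ := exists_mulVec_eq_zero_of_pir i₁ (B₀.col i₀)
    ((Finset.univ.erase i₀).erase i₁) (by simp)
  replace hU₁' : ∀ i, U₁ i i₀ = (1 : Matrix ι ι R) i i₀ := hU₁' i₀ (by simp) h01
  have hV₁ : ∀ i, V₁ i i₀ = (1 : Matrix ι ι R) i i₀ := by
    intro i
    rw [← mul_eq_one_comm.mp hUV₁, Matrix.mul_apply, Finset.sum_eq_single i₀]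
    · simp [hU₁']
    · intro b _ hb; simp [hU₁', Matrix.one_apply_ne hb]
    · simp
  have hmulV₁ : ∀ (N : Matrix ι ι R) i, (N * V₁) i i₀ = N i i₀ := by
    intro N i
    simp [Matrix.mul_apply, hV₁, Matrix.one_apply]
  set B₁ := U₁ * B₀ * V₁ with hB₁
  have hcol : ∀ i, i ≠ i₀ → i ≠ i₁ → B₁ i i₀ = 0 := by
    intro i hi0 hi1
    rw [hB₁, hmulV₁]
    exact hU₁ i (by simp [hi0, hi1])
  set s := B₁ i₁ i₀ with hs
  have hle : B₀.offDiagColIdeal i₀ ≤ Ideal.span {s} := by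
    have hB₁s : B₁.offDiagColIdeal i₀ ≤ Ideal.span {s} := by
      refine Ideal.span_le.mpr ?_
      rintro _ ⟨i, hi, rfl⟩
      by_cases hi1 : i = i₁
      · subst hi1; exact Ideal.mem_span_singleton_self _
      · simp [hcol i hi hi1]
    refine le_trans (Ideal.span_le.mpr ?_) hB₁s
    rintro _ ⟨i, hi, rfl⟩
    have := minor_mem_offDiagColIdeal B₀ U₁ V₁ hUV₁ i₀ i₀ i
    simpa [hV₁, hmulV₁, Matrix.one_apply_ne hi] using this
  have hconj : ∀ U V : Matrix ι ι R, U * V = 1 → s ∈ (U * B₁ * V).offDiagColIdeal i₀ →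
      (U * B₁ * V).offDiagColIdeal i₀ ≤ Ideal.span {s} := by
    intro U V hUV hsJ
    have hmem : (U * B₁ * V).offDiagColIdeal i₀ ∈ S := by
      refine ⟨U * U₁ * U₀, V₀ * V₁ * V, ?_, ?_⟩
      · calc _ = U * (U₁ * (U₀ * V₀) * V₁) * V := by simp only [Matrix.mul_assoc]
          _ = 1 := by simp [hUV₀, hUV₁, hUV]
      · simp only [hB₁, hB₀, Matrix.mul_assoc]
    have h1 : B₀.offDiagColIdeal i₀ ≤ (U * B₁ * V).offDiagColIdeal i₀ :=
      hle.trans ((Ideal.span_singleton_le_iff_mem _).mpr hsJ)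
    by_contra hn
    exact hmax _ hmem (lt_of_le_not_ge h1 fun h => hn (h.trans hle))
  by_cases hu : IsUnit s
  · obtain ⟨t, ht⟩ := hu.exists_left_inv
    have hdiag : Matrix.diagonal (fun i => if i = i₁ then t else 1) *
        Matrix.diagonal (fun i => if i = i₁ then s else 1) = (1 : Matrix ι ι R) := by
      rw [Matrix.diagonal_mul_diagonal, ← Matrix.diagonal_one]
      congr 1; ext i; split_ifs <;> simp [ht]
    have hent : ∀ i, (Matrix.diagonal (fun i => if i = i₁ then t else 1) * U₁ * U₀ * B *
        (V₀ * V₁ * Matrix.diagonal (fun i => if i = i₁ then s else 1))) i i₀ =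
        (if i = i₁ then t else 1) * B₁ i i₀ := by
      intro i
      have : Matrix.diagonal (fun i => if i = i₁ then t else 1) * U₁ * U₀ * B *
        (V₀ * V₁ * Matrix.diagonal (fun i => if i = i₁ then s else 1)) =
        Matrix.diagonal (fun i => if i = i₁ then t else 1) * B₁ *
          Matrix.diagonal (fun i => if i = i₁ then s else 1) := by
        simp only [hB₁, hB₀, Matrix.mul_assoc]
      rw [this, Matrix.mul_diagonal, Matrix.diagonal_mul, if_neg h01, mul_one]
    refine ⟨_, _, ?_, (hent i₁).trans ?_, fun i hi0 hi1 => (hent i).trans ?_⟩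
    · calc _ = Matrix.diagonal (fun i => if i = i₁ then t else 1) * (U₁ * (U₀ * V₀) * V₁) *
            Matrix.diagonal (fun i => if i = i₁ then s else 1) := by
            simp only [Matrix.mul_assoc]
        _ = 1 := by rw [hUV₀, Matrix.mul_one, hUV₁, Matrix.mul_one, hdiag]
    · rw [if_pos rfl, ← hs, ht]
    · rw [hcol i hi0 hi1, mul_zero]
  · exfalso
    obtain ⟨M, hM, hsM⟩ := exists_max_ideal_of_mem_nonunits hu
    set C := B₁ - B₁ i₀ i₀ • (1 : Matrix ι ι R) with hCdef
    have hC : ∀ i, C i i₀ = if i = i₁ then s else 0 := by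
      intro i
      by_cases hi0 : i = i₀
      · subst hi0; simp [hCdef, h01]
      by_cases hi1 : i = i₁
      · subst hi1; simp [hCdef, Matrix.one_apply_ne hi0, hs]
      · simp [hCdef, Matrix.one_apply_ne hi0, hi1, hcol i hi0 hi1]
    have hCM := fun j h0j h1j => mulVec_mem_of_minors (j := j) h01 h0j h1j C s hC (by
      intro v
      obtain ⟨U, V, d, hUV, hv⟩ := exists_eq_smul_col_of_pir i₀ v
      refine ⟨_, fun i k => ?_, hconj U V hUV⟩
      have hBv : ∀ k, (C *ᵥ v) k = d * (B₁ * V) k i₀ - B₁ i₀ i₀ * v k := by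
        intro k
        rw [hCdef, Matrix.sub_mulVec, Matrix.smul_mulVec, Matrix.one_mulVec]
        simp only [Pi.sub_apply, Pi.smul_apply, smul_eq_mul]
        congr 1
        simp only [Matrix.mulVec, dotProduct, Matrix.mul_apply, hv, Finset.mul_sum]
        exact Finset.sum_congr rfl fun l _ => by ring
      have := Ideal.mul_mem_left _ (d * d) (minor_mem_offDiagColIdeal B₁ U V hUV i₀ i k)
      convert this using 1
      rw [hBv, hBv, hv i, hv k]; ring) M hsM
    have hCM' : ∀ i j, C i j ∈ M := by
      have hcolj : ∀ j, i₀ ≠ j → i₁ ≠ j → ∀ i, C i j ∈ M := fun j h0j h1j i => by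
        simpa using hCM j h0j h1j 0 i
      intro i j
      by_cases hj0 : i₀ = j
      · subst hj0; rw [hC]; split_ifs
        · exact hsM
        · exact M.zero_mem
      by_cases hj1 : i₁ = j
      · subst hj1
        have := M.sub_mem (hCM i₂ h02 h12 1 i) (hcolj i₂ h02 h12 i)
        simpa [Matrix.mulVec_add] using this
      · exact hcolj j hj0 hj1 i
    obtain ⟨i, j, hij⟩ := hB M hM (B₁ i₀ i₀)
    apply hij
    have hBC : B - B₁ i₀ i₀ • (1 : Matrix ι ι R) = V₀ * V₁ * C * (U₁ * U₀) := by
      have h0 := mul_eq_one_comm.mp hUV₀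
      have h1 := mul_eq_one_comm.mp hUV₁
      have e1 : V₀ * V₁ * B₁ * (U₁ * U₀) = B := by
        calc _ = V₀ * (V₁ * U₁) * U₀ * B * V₀ * (V₁ * U₁) * U₀ := by
              simp only [hB₁, hB₀, Matrix.mul_assoc]
          _ = (V₀ * U₀) * B * (V₀ * U₀) := by
              simp only [h1, Matrix.mul_one, Matrix.mul_assoc]
          _ = B := by rw [h0, Matrix.one_mul, Matrix.mul_one]
      have e2 : V₀ * V₁ * (U₁ * U₀) = 1 := by
        calc _ = V₀ * (V₁ * U₁) * U₀ := by simp only [Matrix.mul_assoc]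
          _ = 1 := by rw [h1, Matrix.mul_one, h0]
      rw [hCdef, Matrix.mul_sub, Matrix.sub_mul, e1, Matrix.mul_smul, Matrix.smul_mul,
        Matrix.mul_one, e2]
    rw [hBC]
    simp only [Matrix.mul_apply]
    refine Ideal.sum_mem _ fun l _ => Ideal.mul_mem_right _ _ <| Ideal.sum_mem _ fun m _ =>
      Ideal.mul_mem_left _ _ (hCM' m l)

/-- The companion matrix of the polynomial `x ^ (k + 1) + b`. -/
def twistedShift {S : Type*} [CommRing S] (k : ℕ) (b : S) :
    Matrix (Fin (k + 1)) (Fin (k + 1)) S :=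
  Matrix.of fun i j => if (j : ℕ) + 1 = i then 1 else if (j : ℕ) = i + k then -b else 0

section twistedShift

variable {S : Type*} [CommRing S] {k : ℕ} {b : S}

theorem twistedShift_castSucc (i : Fin (k + 1)) (j : Fin k) :
    twistedShift k b i j.castSucc = if i = j.succ then 1 else 0 := by
  simp only [twistedShift, Matrix.of_apply, Fin.ext_iff, Fin.val_castSucc, Fin.val_succ]
  have := j.2
  split_ifs <;> first | rfl | omega

theorem twistedShift_last (i : Fin (k + 1)) :
    twistedShift k b i (Fin.last k) = if i = 0 then -b else 0 := by
  simp only [twistedShift, Matrix.of_apply, Fin.ext_iff, Fin.val_last, Fin.val_zero]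
  have := i.2
  split_ifs <;> first | rfl | omega

theorem mul_twistedShift_castSucc {ι : Type*} (N : Matrix ι (Fin (k + 1)) S) (l : ι) (j : Fin k) :
    (N * twistedShift k b) l j.castSucc = N l j.succ := by
  simp [Matrix.mul_apply, twistedShift_castSucc]

theorem mul_twistedShift_last {ι : Type*} (N : Matrix ι (Fin (k + 1)) S) (l : ι) :
    (N * twistedShift k b) l (Fin.last k) = -b * N l 0 := by
  simp [Matrix.mul_apply, twistedShift_last, mul_comm]

theorem twistedShift_pow_apply {r : ℕ} (hr : r ≤ k + 1) (i j : Fin (k + 1)) :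
    (twistedShift k b ^ r) i j =
      if (j : ℕ) + r = i then 1 else if (j : ℕ) + r = i + (k + 1) then -b else 0 := by
  induction r generalizing i j with
  | zero =>
    have := j.2
    rw [pow_zero, Matrix.one_apply]
    simp only [Fin.ext_iff]
    split_ifs <;> first | rfl | omega
  | succ r ih =>
    rw [pow_succ]
    have := i.2
    refine Fin.lastCases ?_ (fun j => ?_) j
    · rw [mul_twistedShift_last, ih (by omega)]
      simp only [Fin.val_last, Fin.val_zero, zero_add]
      rw [if_neg (show ¬r = i + (k + 1) by omega), if_neg (show ¬k + (r + 1) = i by omega)]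
      by_cases h : r = i
      · rw [if_pos h, if_pos (by omega), mul_one]
      · rw [if_neg h, if_neg (by omega), mul_zero]
    · rw [mul_twistedShift_castSucc, ih (by omega)]
      simp only [Fin.val_castSucc, Fin.val_succ]
      split_ifs <;> first | rfl | omega

theorem twistedShift_pow_mulVec_last {r : ℕ} (hr : r ≤ k) (v : Fin (k + 1) → S)
    (i : Fin (k + 1)) (hi : (i : ℕ) + r = k) :
    (twistedShift k b ^ r *ᵥ v) (Fin.last k) = v i := by
  simp only [Matrix.mulVec, dotProduct]
  rw [Finset.sum_eq_single i]
  · rw [twistedShift_pow_apply (by omega), if_pos (by simpa using hi), one_mul]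
  · intro j _ hj
    have := j.2
    have h : (j : ℕ) ≠ i := fun h => hj (Fin.ext h)
    rw [twistedShift_pow_apply (by omega), Fin.val_last, if_neg (by omega), if_neg (by omega),
      zero_mul]
  · simp

/-- A matrix orthogonal to the powers of the companion matrix, for the trace form, is a commutator
with the companion matrix. -/
theorem exists_commutator_twistedShift (C : Matrix (Fin (k + 1)) (Fin (k + 1)) S)
    (hC : ∀ r ≤ k, (twistedShift k b ^ r * C).trace = 0) :
    ∃ Y, twistedShift k b * Y - Y * twistedShift k b = C := by
  set X := twistedShift k b with hX
  let c : ℕ → Fin (k + 1) → S := fun n => C.col (Fin.ofNat (k + 1) n)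
  obtain ⟨y, hy₀, hy_succ⟩ : ∃ y : ℕ → Fin (k + 1) → S,
      y 0 = 0 ∧ ∀ n, y (n + 1) = X *ᵥ y n - c n :=
    ⟨fun n => Nat.rec 0 (fun n v => X *ᵥ v - c n) n, rfl, fun _ => rfl⟩
  have hy : ∀ n, y n = -∑ i ∈ Finset.range n, X ^ (n - 1 - i) *ᵥ c i := by
    intro n
    induction n with
    | zero => simp [hy₀]
    | succ n ih =>
      rw [hy_succ, ih, Finset.sum_range_succ, Matrix.mulVec_neg, Matrix.mulVec_sum]
      have : ∀ i ∈ Finset.range n, X *ᵥ X ^ (n - 1 - i) *ᵥ c i = X ^ (n + 1 - 1 - i) *ᵥ c i := by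
        intro i hi
        rw [Matrix.mulVec_mulVec, ← pow_succ']
        congr 2
        have := Finset.mem_range.mp hi
        omega
      rw [Finset.sum_congr rfl this]
      simp [sub_eq_add_neg, add_comm]
  have hc : ∀ j : Fin (k + 1), c j = C.col j := fun j => by simp [c]
  have hlast : y (k + 1) = 0 := by
    rw [hy, neg_eq_zero]
    ext i
    have hi := i.2
    rw [← twistedShift_pow_mulVec_last (b := b) (r := k - i) (by omega)
      (∑ j ∈ Finset.range (k + 1), X ^ (k + 1 - 1 - j) *ᵥ c j) i (by omega), ← hX,
      Matrix.mulVec_sum, Finset.sum_apply, Finset.sum_range, Pi.zero_apply,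
      ← hC (k - i) (by omega)]
    refine Finset.sum_congr rfl fun j _ => ?_
    have hj := j.2
    rw [Matrix.mulVec_mulVec, pow_mul_comm, ← Matrix.mulVec_mulVec, hX,
      twistedShift_pow_mulVec_last (by omega) _ j (by omega), hc]
    rfl
  refine ⟨Matrix.of fun l j => y j l, ?_⟩
  ext l j
  have h1 : (X * Matrix.of fun l (j : Fin (k + 1)) => y j l) l j = (X *ᵥ y j) l := rfl
  have h2 : ((Matrix.of fun l (j : Fin (k + 1)) => y j l) * X) l j = y (j + 1) l := by
    refine Fin.lastCases ?_ (fun j => ?_) j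
    · rw [hX, mul_twistedShift_last, Fin.val_last, hlast]
      simp [hy₀]
    · rw [hX, mul_twistedShift_castSucc]
      simp
  rw [Matrix.sub_apply, h1, h2]
  rw [hy_succ, hc]
  simp

theorem exists_commutator_fromBlocks (a b c : S) (hcb : IsCoprime c b)
    (A B : Matrix (Fin (k + 1)) (Fin (k + 1)) S) (hA : A = a • (1 : Matrix _ _ S) + b • B)
    (β : Fin (k + 1) → S) (htr : A.trace + c = 0) :
    ∃ X Y : Matrix (Fin (k + 1) ⊕ Unit) (Fin (k + 1) ⊕ Unit) S,
      Matrix.fromBlocks A (Matrix.of fun i _ => if i = 0 then b else 0)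
        (Matrix.of fun _ j => β j) (Matrix.of fun _ _ => c) = X * Y - Y * X := by
  set X := twistedShift k b with hX
  let w : Fin (k + 1) → S := fun j =>
    if (j : ℕ) < k then -(X ^ ((j : ℕ) + 1) * B).trace else A.trace
  let η : Fin (k + 1) → S := -Pi.single (Fin.last k) 1
  have hηpow : ∀ r (hr : r < k), X ^ (r + 1) *ᵥ η = Pi.single ⟨r, by omega⟩ b := by
    intro r hr
    ext i
    have hi := i.2
    simp only [η, Matrix.mulVec_neg, Matrix.mulVec_single_one, Pi.neg_apply, Matrix.col_apply]
    rw [hX, twistedShift_pow_apply (by omega), Fin.val_last, Pi.single_apply]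
    simp only [Fin.ext_iff]
    split_ifs <;> first | omega | simp
  have hwη : w ⬝ᵥ η = c := by
    simp [η, w]
    linear_combination -htr
  have hXη : X *ᵥ η = Pi.single 0 b := by
    ext i
    simp [η, Matrix.mulVec_neg, hX, twistedShift_last, Pi.single_apply]
    split_ifs <;> simp
  have hC : ∀ r ≤ k, (X ^ r * (A + Matrix.vecMulVec η w)).trace = 0 := by
    intro r hr
    rw [Matrix.mul_add, Matrix.trace_add, Matrix.mul_vecMulVec, Matrix.trace_vecMulVec,
      dotProduct_comm]
    rcases r with - | r
    · rw [pow_zero, Matrix.one_mul, Matrix.one_mulVec, hwη, htr]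
    · have htrX : (X ^ (r + 1)).trace = 0 := by
        refine Finset.sum_eq_zero fun i _ => ?_
        rw [Matrix.diag_apply, hX, twistedShift_pow_apply (by omega), if_neg (by omega),
          if_neg (by omega)]
      rw [hηpow r (by omega), hA]
      simp only [Matrix.mul_add, Matrix.mul_smul, Matrix.mul_one, Matrix.trace_add,
        Matrix.trace_smul, htrX, dotProduct_single, w]
      rw [if_pos (by omega)]
      simp only [smul_eq_mul]
      ring
  obtain ⟨Y, hY⟩ := exists_commutator_twistedShift _ hC
  obtain ⟨p, q, hpq⟩ := hcb
  let g : Fin (k + 1) → S := w ᵥ* Y - β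
  let ζ : S := -(p * g (Fin.last k))
  let ξ : Fin (k + 1) → S :=
    Fin.cons (-(q * g (Fin.last k))) fun j : Fin k => g j.castSucc - ζ * w j.castSucc
  have hξ : ∀ j, (ξ ᵥ* X) j + ζ * w j = g j := by
    intro j
    refine Fin.lastCases ?_ (fun j => ?_) j
    · have h1 : (ξ ᵥ* X) (Fin.last k) = -b * ξ 0 :=
        mul_twistedShift_last (Matrix.of fun (_ : Unit) j => ξ j) ()
      have h2 : w (Fin.last k) = -c := by simp [w]; linear_combination htr
      rw [h1, h2]
      simp only [ξ, Fin.cons_zero, ζ]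
      linear_combination (g (Fin.last k)) * hpq
    · have h1 : (ξ ᵥ* X) j.castSucc = ξ j.succ :=
        mul_twistedShift_castSucc (Matrix.of fun (_ : Unit) j => ξ j) () j
      rw [h1]
      simp [ξ]
  refine ⟨Matrix.fromBlocks X 0 (Matrix.of fun _ j => w j) 0,
    Matrix.fromBlocks Y (Matrix.of fun i _ => η i) (Matrix.of fun _ j => ξ j)
      (Matrix.of fun _ _ => ζ), ?_⟩
  rw [Matrix.fromBlocks_multiply, Matrix.fromBlocks_multiply]
  ext (i | i) (j | j)
  · have := congrFun (congrFun hY i) j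
    simp only [Matrix.sub_apply, Matrix.add_apply, Matrix.vecMulVec_apply] at this
    simp [Matrix.mul_apply (M := Matrix.of fun i (_ : Unit) => η i)]
    linear_combination -this
  · have := congrFun hXη i
    simp only [Matrix.mulVec, dotProduct] at this
    simp [Matrix.mul_apply, this, Pi.single_apply]
  · have := hξ j
    simp only [Matrix.vecMul, dotProduct, g, Pi.sub_apply] at this
    simp [Matrix.mul_apply]
    linear_combination this
  · simp only [dotProduct] at hwη
    simp [Matrix.mul_apply, hwη]

end twistedShift

theorem exists_commutator_fin_two_of_pir {R : Type*} [CommRing R] [IsPrincipalIdealRing R]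
    (A : Matrix (Fin 2) (Fin 2) R) (hA : A.trace = 0) :
    ∃ X Y : Matrix (Fin 2) (Fin 2) R, A = X * Y - Y * X := by
  obtain ⟨g, a, b, ha, hb, x, y, hxy⟩ := exists_eq_mul_isCoprime_of_pir (A 0 0) (A 1 0)
  rw [Matrix.trace_fin_two] at hA
  refine ⟨!![0, a; 0, b], !![0, -(y * A 0 1); g, x * A 0 1], ?_⟩
  ext i j
  fin_cases i <;> fin_cases j <;> simp
  · linear_combination ha
  · linear_combination (-A 0 1) * hxy
  · linear_combination hb
  · linear_combination hA - ha

theorem exists_commutator_of_isCoprime {R : Type*} [CommRing R] [IsPrincipalIdealRing R] {k : ℕ}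
    (A B : Matrix (Fin (k + 3)) (Fin (k + 3)) R) (a b : R) (hab : IsCoprime a b)
    (hA : A = a • (1 : Matrix _ _ R) + b • B) (hB₀ : B 0 0 = 0)
    (hB : ∀ I : Ideal R, (∀ i j, B i j ∈ I) → I = ⊤) (htr : A.trace = 0) :
    ∃ X Y, A = X * Y - Y * X := by
  obtain ⟨U, V, hUV, h₁, h₀⟩ := exists_conj_col_eq_single_of_pir (i₀ := 0) (i₁ := 1)
    (i₂ := (⟨2, by omega⟩ : Fin (k + 3))) (by simp) (by simp [Fin.ext_iff])
    (by simp [Fin.ext_iff]) B (by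
      intro M hM α
      by_contra! h
      have hα : α ∈ M := by simpa [hB₀] using h 0 0
      refine hM.ne_top (hB M fun i j => ?_)
      have := M.add_mem (h i j) (M.mul_mem_right ((1 : Matrix _ _ R) i j) hα)
      simpa using this)
  have hVU := mul_eq_one_comm.mp hUV
  have hA' : U * A * V = a • (1 : Matrix _ _ R) + b • (U * B * V) := by
    simp [hA, Matrix.mul_add, Matrix.add_mul, hUV]
  set B' := U * B * V with hB'
  let e : Fin (k + 2) ⊕ Unit ≃ Fin (k + 3) :=
    ((finSuccEquiv (k + 2)).trans (Equiv.optionEquivSumPUnit _)).symm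
  have he₁ : ∀ i, e (Sum.inl i) = i.succ := fun i => by simp [e]
  have he₂ : ∀ u, e (Sum.inr u) = 0 := fun u => by simp [e]
  have htr' : (U * A * V).trace = 0 := by
    rw [Matrix.trace_mul_comm, ← Matrix.mul_assoc, hVU, Matrix.one_mul, htr]
  have hcop : IsCoprime (a + b * B' 0 0) b := hab.add_mul_left_left _
  obtain ⟨X, Y, hXY⟩ := exists_commutator_fromBlocks (k := k + 1) a b _ hcop
    ((U * A * V).submatrix Fin.succ Fin.succ) (B'.submatrix Fin.succ Fin.succ)
    (by
      rw [hA']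
      ext i j
      simp [Matrix.one_apply])
    (fun j => (U * A * V) 0 j.succ)
    (by
      rw [← htr']
      simp only [Matrix.trace, Matrix.diag_apply, Matrix.submatrix_apply]
      rw [Fin.sum_univ_succ (fun i => (U * A * V) i i), hA']
      simp [add_comm])
  have hblock : (U * A * V).submatrix e e = X * Y - Y * X := by
    rw [← hXY]
    ext (i | i) (j | j)
    · simp [he₁]
    · simp only [Matrix.submatrix_apply, he₁, he₂, Matrix.fromBlocks_apply₁₂, Matrix.of_apply]
      rw [hA']
      simp only [Matrix.add_apply, Matrix.smul_apply, Matrix.one_apply_ne (Fin.succ_ne_zero i),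
        smul_eq_mul, mul_zero, zero_add]
      split_ifs with hi
      · subst hi
        have : B' (Fin.succ 0) 0 = 1 := h₁
        rw [this, mul_one]
      · rw [h₀ _ (Fin.succ_ne_zero i) (fun h => hi (Fin.succ_injective _ h)), mul_zero]
    · simp [he₁, he₂]
    · simp [he₂, hA']
  refine ⟨V * X.submatrix e.symm e.symm * U, V * Y.submatrix e.symm e.symm * U, ?_⟩
  have hconj : ∀ P Q : Matrix (Fin (k + 3)) (Fin (k + 3)) R,
      V * P * U * (V * Q * U) = V * (P * Q) * U := fun P Q => by
    calc _ = V * P * (U * V) * Q * U := by simp only [Matrix.mul_assoc]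
      _ = _ := by rw [hUV, Matrix.mul_one]; simp only [Matrix.mul_assoc]
  have hUAV : U * A * V = (X * Y - Y * X).submatrix e.symm e.symm := by
    rw [← hblock]; simp
  rw [hconj, hconj, ← Matrix.sub_mul, ← Matrix.mul_sub, Matrix.submatrix_mul_equiv,
    Matrix.submatrix_mul_equiv]
  change _ = V * (X * Y - Y * X).submatrix e.symm e.symm * U
  rw [← hUAV]
  calc A = (V * U) * A * (V * U) := by rw [hVU, Matrix.one_mul, Matrix.mul_one]
    _ = _ := by simp only [Matrix.mul_assoc]

theorem exists_eq_smul_one_add_smul_of_pir {R : Type*} [CommRing R] [IsPrincipalIdealRing R]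
    {ι : Type*} [Fintype ι] [DecidableEq ι] [Nontrivial ι] (A : Matrix ι ι R) (i₀ : ι) :
    ∃ (b : R) (B : Matrix ι ι R), A = A i₀ i₀ • (1 : Matrix ι ι R) + b • B ∧ B i₀ i₀ = 0 ∧
      ∀ I : Ideal R, (∀ i j, B i j ∈ I) → I = ⊤ := by
  obtain ⟨i₁, hi₁⟩ := exists_ne i₀
  let q : {p : ι × ι // p ≠ (i₀, i₀)} := ⟨(i₁, i₀), by simp [hi₁]⟩
  obtain ⟨U, V, d, hUV, hV⟩ := exists_eq_smul_col_of_pir q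
    fun p => (A - A i₀ i₀ • (1 : Matrix ι ι R)) p.1.1 p.1.2
  let B : Matrix ι ι R :=
    Matrix.of fun i j => if h : (i, j) ≠ (i₀, i₀) then V ⟨(i, j), h⟩ q else 0
  have hBV : ∀ p : {p : ι × ι // p ≠ (i₀, i₀)}, B p.1.1 p.1.2 = V p q := fun p => dif_pos p.2
  have hB₀ : B i₀ i₀ = 0 := dif_neg (by simp)
  refine ⟨d, B, ?_, hB₀, fun I hI => ?_⟩
  · ext i j
    by_cases h : (i, j) = (i₀, i₀)
    · obtain ⟨rfl, rfl⟩ := Prod.mk.inj h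
      simp [hB₀]
    · have := hV ⟨(i, j), h⟩
      rw [← hBV] at this
      simp only [Matrix.add_apply, Matrix.smul_apply, smul_eq_mul, ← this, Matrix.sub_apply]
      ring
  · rw [Ideal.eq_top_iff_one]
    have h1 : (U * V) q q = 1 := by rw [hUV, Matrix.one_apply_eq]
    rw [← h1, Matrix.mul_apply]
    exact Ideal.sum_mem _ fun p _ => I.mul_mem_left _ (hBV p ▸ hI _ _)

/-- **Corollary.** Let `R` be a commutative principal ideal ring (not necessarily a domain)
and `A` an `n × n` matrix over `R` (`n ≥ 2`) with trace zero. Then `A = XY - YX`. -/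
theorem trace_zero_is_commutator_of_pir {R : Type*} [CommRing R] [IsPrincipalIdealRing R]
    {n : ℕ} (hn : 2 ≤ n) (A : Matrix (Fin n) (Fin n) R)
    (hA : Matrix.trace A = 0) :
    ∃ X Y : Matrix (Fin n) (Fin n) R, A = X * Y - Y * X := by
  obtain rfl | ⟨k, rfl⟩ : n = 2 ∨ ∃ k, n = k + 3 := by
    rcases hn.eq_or_lt with h | h
    · exact Or.inl h.symm
    · exact Or.inr ⟨n - 3, by omega⟩
  · exact exists_commutator_fin_two_of_pir A hA
  obtain ⟨b₀, B, hAB, hB₀, hB⟩ := exists_eq_smul_one_add_smul_of_pir A 0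
  obtain ⟨g, a, b, ha, hb, hab⟩ := exists_eq_mul_isCoprime_of_pir (A 0 0) b₀
  set A₀ := a • (1 : Matrix (Fin (k + 3)) (Fin (k + 3)) R) + b • B with hA₀
  have hgA : A = g • A₀ := by rw [hAB, ha, hb, hA₀, smul_add, smul_smul, smul_smul]
  let K : Ideal R := LinearMap.ker (LinearMap.toSpanSingleton R R g)
  have hK : ∀ z, z ∈ K ↔ g * z = 0 := fun z => by
    simp only [K, LinearMap.mem_ker, LinearMap.toSpanSingleton_apply, smul_eq_mul, mul_comm]
  let f := Ideal.Quotient.mk K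
  have hf : Function.Surjective f := Ideal.Quotient.mk_surjective
  have : IsPrincipalIdealRing (R ⧸ K) := IsPrincipalIdealRing.of_surjective f hf
  obtain ⟨X, Y, hXY⟩ := exists_commutator_of_isCoprime (A₀.map f) (B.map f) (f a) (f b)
    (hab.map f)
    (by
      ext i j
      simp [hA₀, Matrix.one_apply, apply_ite f])
    (by simp [hB₀])
    (by
      intro I hI
      have h := hB (I.comap f) fun i j => hI i j
      rwa [Ideal.comap_eq_top_iff] at h)
    (by
      have h : f A₀.trace = 0 := by
        rw [Ideal.Quotient.eq_zero_iff_mem, hK, ← smul_eq_mul, ← Matrix.trace_smul, ← hgA, hA]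
      rw [← h]
      simp [Matrix.trace])
  choose l hl using hf
  have hlift : ∀ N : Matrix (Fin (k + 3)) (Fin (k + 3)) (R ⧸ K), (N.map l).map f = N := fun N => by
    ext i j; simp [hl]
  have hmem : ∀ i j, g * A₀ i j = g * (X.map l * Y.map l - Y.map l * X.map l) i j := by
    intro i j
    rw [← sub_eq_zero, ← mul_sub, ← hK, ← Ideal.Quotient.eq_zero_iff_mem, map_sub, sub_eq_zero]
    have h : (X.map l * Y.map l - Y.map l * X.map l).map f = A₀.map f := by
      rw [hXY, Matrix.map_sub _ (map_sub f), Matrix.map_mul, Matrix.map_mul, hlift, hlift]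
    exact (congrFun (congrFun h i) j).symm
  refine ⟨g • X.map l, Y.map l, ?_⟩
  rw [hgA, Matrix.smul_mul, Matrix.mul_smul, ← smul_sub]
  ext i j
  exact hmem i j
end

section
/- Let R be a principal ideal domain and let A = (a_ij) be a non-scalar n×n matrix over R with n ≥ 3. Then A is similar to a matrix B = (b_ij) over R such that b_12 divides b_ij for all i ≠ j, b_12 divides b_ii − b_jj for all 1 ≤ i, j ≤ n, and moreover B may be chosen with b_ij = 0 for all i, j with j ≥ i + 2 and 1 ≤ i ≤ n − 2. -/
namespace Matrix

section Wedge

variable {R ι : Type*} [CommRing R] [Fintype ι]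

/-- The `2 × 2` minors of the matrix with rows `v` and `u`. -/
def wedge (v u : ι → R) (i j : ι) : R := v i * u j - v j * u i

theorem dvd_wedge_vecMul {p : R} {v u : ι → R} (h : ∀ i j, p ∣ wedge v u i j)
    (g : Matrix ι ι R) (i j : ι) : p ∣ wedge (v ᵥ* g) (u ᵥ* g) i j := by
  have key : wedge (v ᵥ* g) (u ᵥ* g) i j =
      ∑ k, ∑ l, wedge v u k l * (g k i * g l j) := by
    simp only [wedge, vecMul, dotProduct]
    rw [mul_comm (∑ k, v k * g k j), Finset.sum_mul_sum, Finset.sum_mul_sum,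
      ← Finset.sum_sub_distrib]
    refine Finset.sum_congr rfl fun k _ => ?_
    rw [← Finset.sum_sub_distrib]
    exact Finset.sum_congr rfl fun l _ => by ring
  rw [key]
  exact Finset.dvd_sum fun k _ => Finset.dvd_sum fun l _ => (h k l).mul_right _

theorem wedge_smul_add_smul (A : Matrix ι ι R) (x y : R) (v w : ι → R) (i j : ι) :
    wedge (x • v + y • w) ((x • v + y • w) ᵥ* A) i j =
      x ^ 2 * wedge v (v ᵥ* A) i j + x * y * (wedge v (w ᵥ* A) i j + wedge w (v ᵥ* A) i j) +
        y ^ 2 * wedge w (w ᵥ* A) i j := by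
  simp only [wedge, add_vecMul, smul_vecMul, Pi.add_apply, Pi.smul_apply, smul_eq_mul]
  ring

variable [DecidableEq ι]

/-- The conjugate `g⁻¹ * A * g`. -/
def conjBy (g : (Matrix ι ι R)ˣ) (A : Matrix ι ι R) : Matrix ι ι R :=
  (↑g⁻¹ : Matrix ι ι R) * A * (g : Matrix ι ι R)

theorem conjBy_mul (g h : (Matrix ι ι R)ˣ) (A : Matrix ι ι R) :
    conjBy (g * h) A = conjBy h (conjBy g A) := by
  simp only [conjBy, _root_.mul_inv_rev, Units.val_mul, mul_assoc]

/-- `A` is not scalar modulo any proper principal ideal, expressed through vectors: some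
vector is not an eigenvector. -/
def EverywhereNonscalar (A : Matrix ι ι R) : Prop :=
  ∀ p : R, (∀ w i j, p ∣ wedge w (w ᵥ* A) i j) → IsUnit p

/-- There is a vector which is not an eigenvector of `A` modulo any proper principal ideal. -/
def HasNoneigenvector (A : Matrix ι ι R) : Prop :=
  ∃ v : ι → R, ∀ p : R, (∀ i j, p ∣ wedge v (v ᵥ* A) i j) → IsUnit p

theorem vecMul_conjBy (v : ι → R) (A : Matrix ι ι R) (g : (Matrix ι ι R)ˣ) :
    (v ᵥ* (g : Matrix ι ι R)) ᵥ* conjBy g A = (v ᵥ* A) ᵥ* ↑g := by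
  rw [conjBy, vecMul_vecMul, vecMul_vecMul]
  simp [← mul_assoc]

theorem dvd_wedge_conjBy_iff {p : R} (v : ι → R) (A : Matrix ι ι R) (g : (Matrix ι ι R)ˣ) :
    (∀ i j, p ∣ wedge (v ᵥ* (g : Matrix ι ι R))
      ((v ᵥ* (g : Matrix ι ι R)) ᵥ* conjBy g A) i j) ↔
    ∀ i j, p ∣ wedge v (v ᵥ* A) i j := by
  rw [vecMul_conjBy]
  refine ⟨fun h => ?_, fun h => dvd_wedge_vecMul h _⟩
  have := dvd_wedge_vecMul h (↑g⁻¹ : Matrix ι ι R)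
  simpa [vecMul_vecMul, mul_assoc] using this

theorem EverywhereNonscalar.conjBy {A : Matrix ι ι R} (hA : EverywhereNonscalar A)
    (g : (Matrix ι ι R)ˣ) : EverywhereNonscalar (conjBy g A) :=
  fun p hp => hA p fun w => (dvd_wedge_conjBy_iff w A g).1 (hp _)

theorem HasNoneigenvector.of_conjBy {A : Matrix ι ι R} (g : (Matrix ι ι R)ˣ)
    (h : HasNoneigenvector (conjBy g A)) : HasNoneigenvector A := by
  obtain ⟨v, hv⟩ := h
  refine ⟨v ᵥ* (↑g⁻¹ : Matrix ι ι R), fun p hp => hv p ?_⟩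
  have := (dvd_wedge_conjBy_iff (v ᵥ* (↑g⁻¹ : Matrix ι ι R)) A g).2 hp
  simpa only [vecMul_vecMul, Units.inv_mul, vecMul_one] using this

theorem wedge_sub_smul_one (v : ι → R) (A : Matrix ι ι R) (c : R) (i j : ι) :
    wedge v (v ᵥ* (A - c • 1)) i j = wedge v (v ᵥ* A) i j := by
  simp only [wedge, vecMul_sub, vecMul_smul, vecMul_one, Pi.sub_apply, Pi.smul_apply, smul_eq_mul]
  ring

theorem everywhereNonscalar_sub_smul_one {A : Matrix ι ι R} {c : R} :
    EverywhereNonscalar (A - c • 1) ↔ EverywhereNonscalar A := by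
  simp only [EverywhereNonscalar, wedge_sub_smul_one]

theorem hasNoneigenvector_sub_smul_one {A : Matrix ι ι R} {c : R} :
    HasNoneigenvector (A - c • 1) ↔ HasNoneigenvector A := by
  simp only [HasNoneigenvector, wedge_sub_smul_one]

theorem everywhereNonscalar_of_entries {A : Matrix ι ι R}
    (h : ∀ p : R, (∀ i j, i ≠ j → p ∣ A i j) → (∀ i j, p ∣ A i i - A j j) → IsUnit p) :
    EverywhereNonscalar A := by
  intro p hp
  have off : ∀ i j, i ≠ j → p ∣ A i j := fun i j hij => by
    simpa [wedge, hij, hij.symm] using hp (Pi.single i 1) i j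
  refine h p off fun i j => ?_
  rcases eq_or_ne i j with rfl | hij
  · simp
  have h1 := hp (Pi.single i 1 + Pi.single j 1) i j
  simp only [wedge, add_vecMul, single_vecMul, Pi.add_apply, Pi.single_eq_same, ne_eq, hij,
    hij.symm, not_false_eq_true, Pi.single_eq_of_ne,
    row_apply, one_smul, zero_add, add_zero, one_mul] at h1
  have h2 := dvd_sub ((off i j hij).sub (off j i hij.symm)) h1
  convert h2 using 1
  ring

end Wedge

section Bordered

variable {R : Type*} [CommRing R] {n : ℕ}

/-- The block diagonal matrix with blocks `1` and `h`. -/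
def bordered (h : Matrix (Fin n) (Fin n) R) : Matrix (Fin (n + 1)) (Fin (n + 1)) R :=
  of (Fin.cons (Fin.cons 1 0) fun i => Fin.cons 0 (h i))

@[simp] theorem bordered_zero_zero (h : Matrix (Fin n) (Fin n) R) : bordered h 0 0 = 1 := rfl

@[simp] theorem bordered_zero_succ (h : Matrix (Fin n) (Fin n) R) (j : Fin n) :
    bordered h 0 j.succ = 0 := rfl

@[simp] theorem bordered_succ_zero (h : Matrix (Fin n) (Fin n) R) (i : Fin n) :
    bordered h i.succ 0 = 0 := rfl

@[simp] theorem bordered_succ_succ (h : Matrix (Fin n) (Fin n) R) (i j : Fin n) :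
    bordered h i.succ j.succ = h i j := rfl

theorem bordered_one : bordered (1 : Matrix (Fin n) (Fin n) R) = 1 := by
  ext i j
  refine Fin.cases ?_ (fun i => ?_) i <;> refine Fin.cases ?_ (fun j => ?_) j <;>
    simp [one_apply, Fin.succ_ne_zero, (Fin.succ_ne_zero _).symm]

theorem bordered_mul (h k : Matrix (Fin n) (Fin n) R) :
    bordered (h * k) = bordered h * bordered k := by
  ext i j
  refine Fin.cases ?_ (fun i => ?_) i <;> refine Fin.cases ?_ (fun j => ?_) j <;>
    simp [mul_apply, Fin.sum_univ_succ]

/-- `bordered` as a homomorphism of monoids. -/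
def borderedHom : Matrix (Fin n) (Fin n) R →* Matrix (Fin (n + 1)) (Fin (n + 1)) R where
  toFun := bordered
  map_one' := bordered_one
  map_mul' := bordered_mul

theorem conjBy_borderedHom_zero_succ (h : (Matrix (Fin n) (Fin n) R)ˣ)
    (A : Matrix (Fin (n + 1)) (Fin (n + 1)) R) (j : Fin n) :
    conjBy (Units.map borderedHom h) A 0 j.succ =
      ((fun l => A 0 l.succ) ᵥ* (h : Matrix (Fin n) (Fin n) R)) j := by
  change (bordered (↑h⁻¹ : Matrix (Fin n) (Fin n) R) * A *
    bordered (h : Matrix (Fin n) (Fin n) R)) 0 j.succ = _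
  simp [mul_apply, vecMul, dotProduct, Fin.sum_univ_succ]

theorem conjBy_borderedHom_succ_succ (h : (Matrix (Fin n) (Fin n) R)ˣ)
    (A : Matrix (Fin (n + 1)) (Fin (n + 1)) R) (i j : Fin n) :
    conjBy (Units.map borderedHom h) A i.succ j.succ =
      conjBy h (A.submatrix Fin.succ Fin.succ) i j := by
  change (bordered (↑h⁻¹ : Matrix (Fin n) (Fin n) R) * A *
    bordered (h : Matrix (Fin n) (Fin n) R)) i.succ j.succ = _
  simp [conjBy, mul_apply, Fin.sum_univ_succ]

end Bordered

section Hessenberg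

variable {R : Type*} [CommRing R] [IsDomain R] [IsPrincipalIdealRing R]

/-- A row vector over a PID becomes a multiple of the first unit vector after an invertible
change of coordinates. -/
theorem exists_units_vecMul_eq_single {n : ℕ} (v : Fin (n + 1) → R) :
    ∃ (g : (Matrix (Fin (n + 1)) (Fin (n + 1)) R)ˣ) (d : R),
      v ᵥ* (g : Matrix (Fin (n + 1)) (Fin (n + 1)) R) = Pi.single 0 d := by
  by_cases hv : v = 0
  · exact ⟨1, 0, by simp [hv]⟩
  let f : (Fin (n + 1) → R) →ₗ[R] R := dotProductBilin R R v
  have hf : ∀ x, f x = v ⬝ᵥ x := fun x => rfl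
  obtain ⟨d, hd⟩ := IsPrincipalIdealRing.principal (LinearMap.range f)
  have hmem : ∀ x, ∃ c, c * d = f x := fun x => by
    have : f x ∈ Submodule.span R {d} := hd ▸ LinearMap.mem_range_self f x
    simpa [Submodule.mem_span_singleton] using this
  obtain ⟨y, hy⟩ : d ∈ LinearMap.range f := hd ▸ Submodule.mem_span_singleton_self d
  have hd0 : d ≠ 0 := by
    rintro rfl
    refine hv (funext fun i => ?_)
    obtain ⟨c, hc⟩ := hmem (Pi.single i 1)
    simpa [hf] using hc.symm
  obtain ⟨m, b⟩ := Submodule.basisOfPid (Pi.basisFun R (Fin (n + 1))) (LinearMap.ker f)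
  let e := Module.Basis.mkFinCons y b
    (fun c x hx h => by
      have := congrArg f h
      rw [map_add, map_smul, LinearMap.mem_ker.1 hx, hy] at this
      simpa [hd0] using this)
    (fun z => by
      obtain ⟨c, hc⟩ := hmem z
      exact ⟨-c, by simp [hy, ← hc]⟩)
  obtain rfl : m = n := by
    have := Module.finrank_eq_card_basis e
    simpa using this.symm
  let p := Pi.basisFun R (Fin (m + 1))
  refine ⟨⟨p.toMatrix e, e.toMatrix p, p.toMatrix_mul_toMatrix_flip e,
    e.toMatrix_mul_toMatrix_flip p⟩, d, funext fun j => ?_⟩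
  have hj : (v ᵥ* p.toMatrix e) j = f (e j) := by
    simp [vecMul, hf, p, Module.Basis.toMatrix_apply, dotProduct]
  change (v ᵥ* p.toMatrix e) j = _
  rw [hj]
  refine Fin.cases ?_ (fun j => ?_) j
  · simp [e, hy]
  · simp [e]

theorem exists_conjBy_borderedHom_hessenberg (n : ℕ)
    (A : Matrix (Fin (n + 1)) (Fin (n + 1)) R) :
    ∃ h : (Matrix (Fin n) (Fin n) R)ˣ, ∀ i j : Fin (n + 1), (i : ℕ) + 2 ≤ j →
      conjBy (Units.map borderedHom h) A i j = 0 := by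
  induction n with
  | zero => exact ⟨1, fun i j hij => by omega⟩
  | succ n ih =>
    obtain ⟨h₁, d, hd⟩ := exists_units_vecMul_eq_single fun l => A 0 (Fin.succ l)
    obtain ⟨h₂, hh⟩ := ih ((conjBy (Units.map borderedHom h₁) A).submatrix Fin.succ Fin.succ)
    refine ⟨h₁ * Units.map borderedHom h₂, fun i j hij => ?_⟩
    rw [map_mul, conjBy_mul]
    obtain ⟨j, rfl⟩ := Fin.exists_succ_eq.2 (show j ≠ 0 by rintro rfl; simp at hij)
    refine Fin.cases (fun hij => ?_) (fun i hij => ?_) i hij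
    · simp only [conjBy_borderedHom_zero_succ, hd]
      obtain ⟨j, rfl⟩ := Fin.exists_succ_eq.2 (show j ≠ 0 by rintro rfl; simp at hij)
      simp [borderedHom]
    · rw [conjBy_borderedHom_succ_succ]
      exact hh i j (by simp at hij; omega)

/-- Every vector is the first basis vector, up to a scalar, in suitable coordinates in which `A`
is lower Hessenberg. -/
theorem exists_conjBy_hessenberg {n : ℕ} (A : Matrix (Fin (n + 2)) (Fin (n + 2)) R)
    (v : Fin (n + 2) → R) :
    ∃ g : (Matrix (Fin (n + 2)) (Fin (n + 2)) R)ˣ,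
      (∀ i j : Fin (n + 2), (i : ℕ) + 2 ≤ j → conjBy g A i j = 0) ∧
      ∀ p, p ∣ conjBy g A 0 1 → ∀ i j, p ∣ wedge v (v ᵥ* A) i j := by
  obtain ⟨g, d, hd⟩ := exists_units_vecMul_eq_single v
  obtain ⟨h, hh⟩ := exists_conjBy_borderedHom_hessenberg _ (conjBy g A)
  rw [← conjBy_mul] at hh
  set k := Units.map borderedHom h with hk
  refine ⟨g * k, hh, fun p hp => (dvd_wedge_conjBy_iff v A (g * k)).1 ?_⟩
  have hv : v ᵥ* (↑(g * k) : Matrix (Fin (n + 2)) (Fin (n + 2)) R) = Pi.single 0 d := by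
    rw [Units.val_mul, ← vecMul_vecMul, hd]
    ext j
    change (Pi.single 0 d ᵥ* bordered (h : Matrix _ _ R)) j = _
    refine Fin.cases ?_ (fun j => ?_) j <;> simp
  rw [hv]
  have row : ∀ j, j ≠ 0 → p ∣ conjBy (g * k) A 0 j := by
    intro j hj
    rcases eq_or_ne j 1 with rfl | hj1
    · exact hp
    · have h0 : (j : ℕ) ≠ 0 := fun h => hj (Fin.ext h)
      have h1 : (j : ℕ) ≠ 1 := fun h => hj1 (Fin.ext h)
      rw [hh 0 j (show 0 + 2 ≤ (j : ℕ) by omega)]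
      exact dvd_zero p
  intro i j
  generalize conjBy (g * k) A = B at row
  rcases eq_or_ne i 0 with rfl | hi <;> rcases eq_or_ne j 0 with rfl | hj
  · simp [wedge]
  · simpa [wedge, hj] using ((row j hj).mul_left _).mul_left _
  · simpa [wedge, hi] using ((row i hi).mul_left _).mul_left _
  · simp [wedge, hi, hj]

end Hessenberg

section CubicForm

variable {R M : Type*} [CommRing R] [AddCommGroup M] [Module R M]

/-- The restriction of `D` to the line `w + s • u` is a cubic polynomial in `s` with leading
coefficient `D u`. -/
def IsCubicForm (D : M → R) : Prop :=
  ∀ w u, ∃ a b c, ∀ s : R, D (w + s • u) = a + b * s + c * s ^ 2 + D u * s ^ 3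

theorem isCubicForm_mul (f g h : M →ₗ[R] R) : IsCubicForm fun w => f w * g w * h w := by
  intro w u
  refine ⟨f w * g w * h w, f u * g w * h w + f w * g u * h w + f w * g w * h u,
    f u * g u * h w + f u * g w * h u + f w * g u * h u, fun s => ?_⟩
  simp only [map_add, map_smul, smul_eq_mul]
  ring

theorem IsCubicForm.sub {D E : M → R} (hD : IsCubicForm D) (hE : IsCubicForm E) :
    IsCubicForm fun w => D w - E w := by
  intro w u
  obtain ⟨a, b, c, h⟩ := hD w u
  obtain ⟨a', b', c', h'⟩ := hE w u
  exact ⟨a - a', b - b', c - c', fun s => by simp only [h, h']; ring⟩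

theorem IsCubicForm.const_mul {D : M → R} (hD : IsCubicForm D) (r : R) :
    IsCubicForm fun w => r * D w := by
  intro w u
  obtain ⟨a, b, c, h⟩ := hD w u
  exact ⟨r * a, r * b, r * c, fun s => by simp only [h]; ring⟩

theorem IsCubicForm.exists_ne_zero [IsDomain R] [Infinite R] {D : M → R} (hD : IsCubicForm D)
    (w : M) {u : M} (hu : D u ≠ 0) {r : R} (hr : r ≠ 0) : ∃ t : R, D (w + (r * t) • u) ≠ 0 := by
  obtain ⟨a, b, c, h⟩ := hD w u
  by_contra! h0
  open Polynomial in
  let P : R[X] := C a + C (b * r) * X + C (c * r ^ 2) * X ^ 2 + C (D u * r ^ 3) * X ^ 3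
  have hP : P = 0 := Polynomial.funext fun t => by
    have := h0 t
    rw [h] at this
    simp only [P, Polynomial.eval_add, Polynomial.eval_mul, Polynomial.eval_C, Polynomial.eval_X,
      Polynomial.eval_pow, Polynomial.eval_zero]
    rw [← this]
    ring
  have h3 : P.coeff 3 = D u * r ^ 3 := by
    simp only [P, Polynomial.coeff_add, Polynomial.coeff_C_mul, Polynomial.coeff_X_pow,
      Polynomial.coeff_X, Polynomial.coeff_C]
    simp
  rw [hP, Polynomial.coeff_zero] at h3
  exact mul_ne_zero hu (pow_ne_zero 3 hr) h3.symm

end CubicForm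

section Avoidance

variable {R ι : Type*} [CommRing R] [IsDomain R] [IsPrincipalIdealRing R] [Fintype ι]

theorem exists_prime_dvd_of_not_isUnit {b p : R} (hb0 : b ≠ 0) (hb : ¬IsUnit b)
    (hp : ¬IsUnit p) : ∃ q, Prime q ∧ q ∣ p := by
  rcases eq_or_ne p 0 with rfl | hp0
  · obtain ⟨q, hq, -⟩ := WfDvdMonoid.exists_irreducible_factor hb hb0
    exact ⟨q, hq.prime, dvd_zero q⟩
  · obtain ⟨q, hq, h⟩ := WfDvdMonoid.exists_irreducible_factor hp hp0
    exact ⟨q, hq.prime, h⟩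

theorem exists_prime_to_cover {D : R} (b : R) (hD : D ≠ 0) :
    ∃ y : R, (∀ p, Prime p → p ∣ y → ¬p ∣ b) ∧ ∀ p, Prime p → p ∣ D → p ∣ b ∨ p ∣ y := by
  induction D using UniqueFactorizationMonoid.induction_on_prime with
  | h₁ => exact absurd rfl hD
  | h₂ x hx => exact ⟨1, fun p hp h => absurd (isUnit_of_dvd_one h) hp.not_isUnit,
      fun p hp h => absurd (isUnit_of_dvd_unit h hx) hp.not_isUnit⟩
  | h₃ a q ha hq ih =>
    obtain ⟨y, hy, hay⟩ := ih ha
    by_cases hqb : q ∣ b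
    · refine ⟨y, hy, fun p hp h => ?_⟩
      rcases hp.dvd_or_dvd h with h | h
      · exact .inl (((hp.dvd_prime_iff_associated hq).1 h).dvd.trans hqb)
      · exact hay p hp h
    · refine ⟨q * y, fun p hp h hpb => ?_, fun p hp h => ?_⟩
      · rcases hp.dvd_or_dvd h with h | h
        · exact hqb (((hp.dvd_prime_iff_associated hq).1 h).symm.dvd.trans hpb)
        · exact hy p hp h hpb
      · rcases hp.dvd_or_dvd h with h | h
        · exact .inr (h.mul_right y)
        · exact (hay p hp h).imp_right (·.mul_left q)

theorem exists_noneigenvector_of_ne_zero {A : Matrix ι ι R}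
    (hA : ∀ p, Prime p → ∃ w, ¬∀ i j, p ∣ wedge w (w ᵥ* A) i j) {b : R} (hb : b ≠ 0) :
    ∃ w, ∀ p, Prime p → p ∣ b → ¬∀ i j, p ∣ wedge w (w ᵥ* A) i j := by
  induction b using UniqueFactorizationMonoid.induction_on_prime with
  | h₁ => exact absurd rfl hb
  | h₂ x hx => exact ⟨0, fun p hp h => absurd (isUnit_of_dvd_unit h hx) hp.not_isUnit⟩
  | h₃ a q ha hq ih =>
    obtain ⟨w, hw⟩ := ih ha
    by_cases hqw : ∀ i j, q ∣ wedge w (w ᵥ* A) i j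
    · obtain ⟨w', hw'⟩ := hA q hq
      have hqa : ¬q ∣ a := fun h => hw q hq h hqw
      refine ⟨a • w' + q • w, fun p hp hpa h => ?_⟩
      simp only [wedge_smul_add_smul] at h
      by_cases hpq : p ∣ q
      · have hqp := ((hp.dvd_prime_iff_associated hq).1 hpq).symm.dvd
        refine hw' fun i j => ?_
        have h1 := hqp.trans (h i j)
        rw [add_assoc, dvd_add_left (dvd_add ((dvd_mul_left q a).mul_right _)
          ((dvd_pow_self q two_ne_zero).mul_right _))] at h1
        exact (hq.dvd_or_dvd h1).resolve_left fun h => hqa (hq.dvd_of_dvd_pow h)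
      · have hpa' := (hp.dvd_or_dvd hpa).resolve_left hpq
        refine hw p hp hpa' fun i j => ?_
        have h1 := h i j
        rw [dvd_add_right (dvd_add ((dvd_pow hpa' two_ne_zero).mul_right _)
          ((hpa'.mul_right q).mul_right _))] at h1
        exact (hp.dvd_or_dvd h1).resolve_left fun h => hpq (hp.dvd_of_dvd_pow h)
    · refine ⟨w, fun p hp hpa => ?_⟩
      rcases hp.dvd_or_dvd hpa with h | h
      · exact fun h' => hqw fun i j =>
          ((hp.dvd_prime_iff_associated hq).1 h).symm.dvd.trans (h' i j)
      · exact hw p hp h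

/-- If `v` is an eigenvector only modulo primes dividing `b`, and `w` is an eigenvector modulo
none of these, and the pencil spanned by `v` and `w` has finitely many bad primes, then some
member of the pencil is an eigenvector modulo no prime. -/
theorem exists_noneigenvector_of_pencil {A : Matrix ι ι R} {v w : ι → R} {b D : R} (hD : D ≠ 0)
    (hv : ∀ p, Prime p → (∀ i j, p ∣ wedge v (v ᵥ* A) i j) → p ∣ b)
    (hw : ∀ p, Prime p → p ∣ b → ¬∀ i j, p ∣ wedge w (w ᵥ* A) i j)
    (hvw : ∀ p, Prime p → ∀ x y : R, ¬p ∣ y →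
      (∀ i j, p ∣ wedge (x • v + y • w) ((x • v + y • w) ᵥ* A) i j) → p ∣ D) :
    ∃ z, ∀ p, Prime p → ¬∀ i j, p ∣ wedge z (z ᵥ* A) i j := by
  obtain ⟨y, hyb, hDy⟩ := exists_prime_to_cover b hD
  refine ⟨b • v + y • w, fun p hp h => ?_⟩
  by_cases hpy : p ∣ y
  · have hpb := hyb p hp hpy
    refine hpb (hv p hp fun i j => ?_)
    have h1 := h i j
    rw [wedge_smul_add_smul, add_assoc, dvd_add_left (dvd_add ((hpy.mul_left b).mul_right _)
      ((dvd_pow hpy two_ne_zero).mul_right _))] at h1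
    exact (hp.dvd_or_dvd h1).resolve_left fun h => hpb (hp.dvd_of_dvd_pow h)
  · have hpb := (hDy p hp (hvw p hp b y hpy h)).resolve_right hpy
    refine hw p hp hpb fun i j => ?_
    have h1 := h i j
    rw [wedge_smul_add_smul, dvd_add_right (dvd_add ((dvd_pow hpb two_ne_zero).mul_right _)
      ((hpb.mul_right y).mul_right _))] at h1
    exact (hp.dvd_or_dvd h1).resolve_left fun h => hpy (hp.dvd_of_dvd_pow h)

end Avoidance

section Core

variable {R : Type*} [CommRing R] [IsDomain R] [IsPrincipalIdealRing R]

theorem exists_bezout_cofactors (c d : R) :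
    ∃ g a b x y : R, c = g * a ∧ d = g * b ∧ x * a + y * b = 1 := by
  by_cases h : c = 0 ∧ d = 0
  · exact ⟨0, 1, 0, 1, 0, by simp [h.1], by simp [h.2], by simp⟩
  obtain ⟨x, y, hxy⟩ := IsBezout.gcd_eq_sum c d
  obtain ⟨a, ha⟩ := IsBezout.gcd_dvd_left c d
  obtain ⟨b, hb⟩ := IsBezout.gcd_dvd_right c d
  refine ⟨_, a, b, x, y, ha, hb, ?_⟩
  have hg : IsBezout.gcd c d ≠ 0 := fun h0 =>
    h ⟨by rw [ha, h0, zero_mul], by rw [hb, h0, zero_mul]⟩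
  refine mul_left_cancel₀ hg ?_
  linear_combination hxy - x * ha - y * hb

theorem hasNoneigenvector_of_col {n : ℕ} {M : Matrix (Fin (n + 3)) (Fin (n + 3)) R}
    (hM : ∀ i j, j ≠ 0 → M i j = 0) (h : EverywhereNonscalar M) : HasNoneigenvector M := by
  obtain ⟨v, hv⟩ : ∃ v : Fin (n + 3) → R, ∑ i, v i * M i 0 = 1 := by
    obtain ⟨p, hp⟩ := IsPrincipalIdealRing.principal (Ideal.span (Set.range fun i => M i 0))
    rw [Ideal.submodule_span_eq] at hp
    have hdvd : ∀ i, p ∣ M i 0 := fun i =>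
      Ideal.mem_span_singleton.1 (hp ▸ Ideal.subset_span ⟨i, rfl⟩)
    have hunit : IsUnit p := h p fun w i j => by
      have : ∀ j, p ∣ (w ᵥ* M) j := fun j => by
        change p ∣ ∑ i, w i * M i j
        refine Finset.dvd_sum fun i _ => ?_
        rcases eq_or_ne j 0 with rfl | hj
        · exact (hdvd i).mul_left _
        · simp [hM i j hj]
      exact ((this j).mul_left _).sub ((this i).mul_left _)
    exact Ideal.mem_span_range_iff_exists_fun.1
      (by rw [hp, Ideal.span_singleton_eq_top.2 hunit]; trivial)
  obtain ⟨g, a, b, x, y, ha, hb, hxy⟩ := exists_bezout_cofactors (M 1 0) (M 2 0)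
  let t := a * v 1 + b * v 2
  let z : Fin (n + 3) → R := Fin.cons (v 0) (Fin.cons (t * x + b) (Fin.cons (t * y - a)
    fun i => v i.succ.succ.succ))
  have hz : (z ᵥ* M) 0 = 1 := by
    rw [← hv]
    simp only [vecMul, dotProduct, Fin.sum_univ_succ, z, Fin.cons_zero, Fin.cons_succ]
    change _ + ((t * x + b) * M 1 0 + ((t * y - a) * M 2 0 + _)) =
      _ + (v 1 * M 1 0 + (v 2 * M 2 0 + _))
    rw [ha, hb]
    linear_combination (g * (a * v 1 + b * v 2)) * hxy
  have hz' : ∀ j, j ≠ 0 → (z ᵥ* M) j = 0 := fun j hj => by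
    simp [vecMul, dotProduct, hM _ j hj]
  refine ⟨z, fun p hp => isUnit_of_dvd_one ?_⟩
  have h20 : (2 : Fin (n + 3)) ≠ 0 := by
    simp [Fin.ext_iff, Nat.mod_eq_of_lt (show 2 < n + 3 by omega)]
  have h1 := hp 1 0
  have h2 := hp 2 0
  simp only [wedge, hz, hz' 1 (by simp), hz' 2 h20, mul_one, mul_zero,
    sub_zero] at h1 h2
  change p ∣ t * x + b at h1
  change p ∣ t * y - a at h2
  have h3 := (h1.mul_left y).sub (h2.mul_left x)
  have h4 : y * (t * x + b) - x * (t * y - a) = 1 := by linear_combination hxy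
  rwa [h4] at h3

theorem hasNoneigenvector_of_rank_one {n : ℕ} {M : Matrix (Fin (n + 3)) (Fin (n + 3)) R}
    (h01 : M 0 1 ≠ 0) (hM : ∀ i j, M 0 1 * M i j = M i 1 * M 0 j)
    (h : EverywhereNonscalar M) : HasNoneigenvector M := by
  obtain ⟨g, d, hd⟩ := exists_units_vecMul_eq_single (M 0)
  refine .of_conjBy g (hasNoneigenvector_of_col (fun i j hj => ?_) (h.conjBy g))
  have hcol : ∀ k, (M * (g : Matrix (Fin (n + 3)) (Fin (n + 3)) R)) k j = 0 := fun k => by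
    refine (mul_eq_zero.1 ?_).resolve_left h01
    have hd' := congrFun hd j
    simp only [vecMul, dotProduct, Pi.single_eq_of_ne hj] at hd'
    rw [mul_apply, Finset.mul_sum]
    simp only [← mul_assoc, hM]
    simp only [mul_assoc, ← Finset.mul_sum, hd', mul_zero]
  rw [conjBy, Matrix.mul_assoc, mul_apply]
  simp [hcol]

theorem hasNoneigenvector_of_cubicForm {n : ℕ} {A : Matrix (Fin (n + 3)) (Fin (n + 3)) R}
    (hA : EverywhereNonscalar A) (h01 : A 0 1 ≠ 0) {D : (Fin (n + 3) → R) → R}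
    (hD : IsCubicForm D) {u : Fin (n + 3) → R} (hu : D u ≠ 0)
    (hbad : ∀ w p, Prime p → ∀ x y : R, ¬p ∣ y →
      (∀ i j, p ∣ wedge (x • Pi.single 0 1 + y • w) ((x • Pi.single 0 1 + y • w) ᵥ* A) i j) →
      p ∣ D w) : HasNoneigenvector A := by
  have he : wedge (Pi.single 0 1) (Pi.single 0 1 ᵥ* A) 0 1 = A 0 1 := by simp [wedge]
  by_cases hb : IsUnit (A 0 1)
  · exact ⟨Pi.single 0 1, fun p hp => isUnit_of_dvd_unit (he ▸ hp 0 1) hb⟩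
  have : Infinite R := by
    by_contra hfin
    rw [not_infinite_iff_finite] at hfin
    obtain ⟨c, hc⟩ := (Finite.isField_of_domain R).mul_inv_cancel h01
    exact hb (.of_mul_eq_one c hc)
  obtain ⟨w, hw⟩ := exists_noneigenvector_of_ne_zero (A := A) (fun p hp => by
    by_contra! h
    exact hp.not_isUnit (hA p h)) h01
  obtain ⟨t, ht⟩ := hD.exists_ne_zero w hu h01
  obtain ⟨z, hz⟩ := exists_noneigenvector_of_pencil (A := A) (v := Pi.single 0 1)
    (w := w + (A 0 1 * t) • u) (b := A 0 1) ht (fun p _ h => he ▸ h 0 1)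
    (fun p hp hpb h => hw p hp hpb fun i j => by
      have h1 := h i j
      have h2 := wedge_smul_add_smul A 1 (A 0 1 * t) w u i j
      rw [one_smul] at h2
      have hpt : p ∣ A 0 1 * t := hpb.mul_right t
      rwa [h2, add_assoc, dvd_add_left (dvd_add ((hpt.mul_left 1).mul_right _)
        ((dvd_pow hpt two_ne_zero).mul_right _)), one_pow, one_mul] at h1)
    (fun p hp x y hy h => hbad _ p hp x y hy h)
  refine ⟨z, fun p hp => ?_⟩
  by_contra hpu
  obtain ⟨q, hq, hqp⟩ := exists_prime_dvd_of_not_isUnit h01 hb hpu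
  exact hz q hq fun i j => hqp.trans (hp i j)

theorem hasNoneigenvector_of_row {n : ℕ} {A : Matrix (Fin (n + 3)) (Fin (n + 3)) R}
    (hA : EverywhereNonscalar A) (h01 : A 0 1 ≠ 0) (hrow : ∀ j, j ≠ 1 → A 0 j = 0) :
    HasNoneigenvector A := by
  by_contra hno
  let c (j : Fin (n + 3)) : (Fin (n + 3) → R) →ₗ[R] R := LinearMap.proj j
  let α (j : Fin (n + 3)) : (Fin (n + 3) → R) →ₗ[R] R := c j ∘ₗ A.vecMulLinear
  have hα : ∀ j w, (w ᵥ* A) j = α j w := fun j w => rfl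
  have hc : ∀ j w, w j = c j w := fun j w => rfl
  have pencil : ∀ (x y : R) w j, ((x • Pi.single 0 1 + y • w) ᵥ* A) j = x * A 0 j + y * α j w := by
    intro x y w j
    rw [← hα]
    simp [add_vecMul, smul_vecMul]
  have hD : ∀ j, j ≠ 0 → j ≠ 1 → ∀ w, α j w * α j w * c 1 w - α j w * c j w * α 1 w -
      A 0 1 * (c j w * c j w * α 0 w) - -A 0 1 * (c 0 w * c j w * α j w) = 0 := by
    intro j hj0 hj1 u
    by_contra hu
    refine hno (hasNoneigenvector_of_cubicForm hA h01
      ((((isCubicForm_mul (α j) (α j) (c 1)).sub (isCubicForm_mul (α j) (c j) (α 1))).sub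
        ((isCubicForm_mul (c j) (c j) (α 0)).const_mul (A 0 1))).sub
        ((isCubicForm_mul (c 0) (c j) (α j)).const_mul (-A 0 1))) hu fun w p hp x y hy h => ?_)
    have h0 := h 0 j
    have h1 := h 1 j
    simp only [wedge, pencil, hrow j hj1, hrow 0 (by simp), Pi.add_apply, Pi.smul_apply,
      smul_eq_mul, Pi.single_eq_same, Pi.single_eq_of_ne hj0, Pi.single_eq_of_ne (one_ne_zero' _),
      fun j => hc j w] at h0 h1
    have h2 := (h1.mul_left (α j w)).add (h0.mul_left (c j w * A 0 1))
    refine (hp.dvd_or_dvd (a := y ^ 2) ?_).resolve_left fun h => hy (hp.dvd_of_dvd_pow h)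
    convert h2 using 1
    ring
  have hE : ∀ j k, j ≠ 0 → j ≠ 1 → k ≠ 0 → k ≠ 1 → ∀ w,
      c 1 w * c j w * α k w - c 1 w * c k w * α j w = 0 := by
    intro j k hj0 hj1 hk0 hk1 u
    by_contra hu
    refine hno (hasNoneigenvector_of_cubicForm hA h01
      ((isCubicForm_mul (c 1) (c j) (α k)).sub (isCubicForm_mul (c 1) (c k) (α j))) hu
      fun w p hp x y hy h => ?_)
    have h0 := h 1 j
    have h1 := h 1 k
    simp only [wedge, pencil, hrow j hj1, hrow k hk1, Pi.add_apply, Pi.smul_apply,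
      smul_eq_mul, Pi.single_eq_of_ne hj0, Pi.single_eq_of_ne hk0,
      Pi.single_eq_of_ne (one_ne_zero' _), fun j => hc j w] at h0 h1
    have h2 := (h1.mul_left (c j w)).sub (h0.mul_left (c k w))
    refine (hp.dvd_or_dvd (a := y ^ 2) ?_).resolve_left fun h => hy (hp.dvd_of_dvd_pow h)
    convert h2 using 1
    ring
  have αadd : ∀ i j k, α i (Pi.single j 1 + Pi.single k 1) = A j i + A k i := by
    intro i j k
    simp [← hα, add_vecMul]
  have αsingle : ∀ i j, α i (Pi.single j 1) = A j i := by
    intro i j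
    simp [← hα]
  have row1 : ∀ j, j ≠ 0 → j ≠ 1 → A 1 j = 0 := by
    intro j hj0 hj1
    have := hD j hj0 hj1 (Pi.single 1 1)
    simpa [αsingle, ← hc, hj0, hj1] using this
  have off : ∀ k j, j ≠ 0 → j ≠ 1 → k ≠ 0 → k ≠ 1 → k ≠ j → A k j = 0 := by
    intro k j hj0 hj1 hk0 hk1 hkj
    have := hD j hj0 hj1 (Pi.single 1 1 + Pi.single k 1)
    simpa [αadd, ← hc, hj0, hj1, hk0, hk1, hk1.symm, hkj, hkj.symm, row1 j hj0 hj1] using this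
  have h20 : (2 : Fin (n + 3)) ≠ 0 := by
    simp [Fin.ext_iff, Nat.mod_eq_of_lt (show 2 < n + 3 by omega)]
  have h21 : (2 : Fin (n + 3)) ≠ 1 := by
    simp [Fin.ext_iff, Nat.mod_eq_of_lt (show 2 < n + 3 by omega)]
  have diag : ∀ j, j ≠ 0 → j ≠ 1 → A j j = A 2 2 := by
    intro j hj0 hj1
    rcases eq_or_ne j 2 with rfl | hj2
    · rfl
    have := hE 2 j h20 h21 hj0 hj1 (Pi.single 1 1 + (Pi.single 2 1 + Pi.single j 1))
    simp only [map_add, αsingle, ← hc, Pi.add_apply] at this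
    simpa [hj0, hj1, hj2, h20, h21, hj0.symm, hj1.symm, hj2.symm, h20.symm, h21.symm,
      row1 j hj0 hj1, row1 2 h20 h21, off 2 j hj0 hj1 h20 h21 hj2.symm,
      off j 2 h20 h21 hj0 hj1 hj2, sub_eq_zero] using this
  have low : ∀ k, k ≠ 0 → k ≠ 1 → A 2 2 * A k 1 + A 0 1 * A k 0 = 0 := by
    intro k hk0 hk1
    have := hD k hk0 hk1 (Pi.single k 1)
    simp only [αsingle, ← hc] at this
    simp [hk0.symm, hk1.symm, diag k hk0 hk1] at this
    linear_combination -this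
  have corner : A 2 2 * (A 2 2 - A 1 1) - A 0 1 * A 1 0 = 0 := by
    have := hD 2 h20 h21 (Pi.single 1 1 + Pi.single 2 1)
    simp only [αadd, ← hc, Pi.add_apply] at this
    simp [h20.symm, h21.symm, row1 2 h20 h21] at this
    linear_combination this + low 2 h20 h21
  rw [← hasNoneigenvector_sub_smul_one (c := A 2 2)] at hno
  refine hno (hasNoneigenvector_of_rank_one ?_ (fun i j => ?_)
    (everywhereNonscalar_sub_smul_one.2 hA))
  · simpa using h01
  simp only [sub_apply, smul_apply, one_apply, smul_eq_mul]
  rcases eq_or_ne j 1 with rfl | hj1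
  · simp only [mul_comm]
  rcases eq_or_ne i 0 with rfl | hi0
  · simp
  rcases eq_or_ne j 0 with rfl | hj0
  · rcases eq_or_ne i 1 with rfl | hi1
    · simp [hrow 0]
      linear_combination -corner
    · simp [hrow 0, hi0, hi1]
      linear_combination low i hi0 hi1
  · rcases eq_or_ne i 1 with rfl | hi1
    · simp [hrow j hj1, row1 j hj0 hj1, hj0.symm, hj1.symm]
    · rcases eq_or_ne i j with rfl | hij
      · simp [hrow i hi1, diag i hi0 hi1, hi0.symm]
      · simp [hrow j hj1, off i j hj0 hj1 hi0 hi1 hij, hj0.symm, hij]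

theorem EverywhereNonscalar.hasNoneigenvector {n : ℕ}
    {A : Matrix (Fin (n + 3)) (Fin (n + 3)) R} (hA : EverywhereNonscalar A) :
    HasNoneigenvector A := by
  obtain ⟨w, hw⟩ : ∃ w, ¬∀ i j, (0 : R) ∣ wedge w (w ᵥ* A) i j := by
    by_contra! h
    exact not_isUnit_zero (hA 0 h)
  obtain ⟨g, hess, hg⟩ := exists_conjBy_hessenberg A w
  refine .of_conjBy g ((hasNoneigenvector_sub_smul_one (c := Matrix.conjBy g A 0 0)).1
    (hasNoneigenvector_of_row (everywhereNonscalar_sub_smul_one.2 (hA.conjBy g))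
      ?_ fun j hj => ?_))
  · have h : Matrix.conjBy g A 0 1 ≠ 0 := fun h => hw (hg 0 (zero_dvd_iff.2 h))
    simpa using h
  · rcases eq_or_ne j 0 with rfl | hj0
    · simp
    · have h0 : (j : ℕ) ≠ 0 := fun h => hj0 (Fin.ext h)
      have h1 : (j : ℕ) ≠ 1 := fun h => hj (Fin.ext h)
      simp [hj0.symm, hess 0 j (show 0 + 2 ≤ (j : ℕ) by omega)]

/-- A non-scalar matrix is a scalar matrix plus a multiple of a matrix which is nonscalar
modulo every proper principal ideal. -/
theorem exists_eq_smul_one_add_smul {n : ℕ} {A : Matrix (Fin (n + 1)) (Fin (n + 1)) R}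
    (hA : ∀ c : R, A ≠ c • 1) :
    ∃ (a d : R) (A' : Matrix (Fin (n + 1)) (Fin (n + 1)) R),
      A = a • 1 + d • A' ∧ EverywhereNonscalar A' := by
  let f : Fin (n + 1) × Fin (n + 1) → R := fun x => (A - A 0 0 • 1) x.1 x.2
  obtain ⟨d, hd⟩ := IsPrincipalIdealRing.principal (Ideal.span (Set.range f))
  rw [Ideal.submodule_span_eq] at hd
  have hdvd : ∀ i j, d ∣ (A - A 0 0 • 1) i j := fun i j =>
    Ideal.mem_span_singleton.1 (hd ▸ Ideal.subset_span ⟨(i, j), rfl⟩)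
  choose A' hA' using hdvd
  have heq : A - A 0 0 • 1 = d • of A' := by
    ext i j
    exact hA' i j
  have hd0 : d ≠ 0 := by
    rintro rfl
    rw [zero_smul, sub_eq_zero] at heq
    exact hA _ heq
  have h00 : A' 0 0 = 0 := by
    have := hA' 0 0
    simpa [hd0] using this.symm
  refine ⟨A 0 0, d, of A', by rw [← heq]; abel,
    everywhereNonscalar_of_entries fun p hoff hdiag => ?_⟩
  have hp : ∀ i j, p ∣ A' i j := by
    intro i j
    rcases eq_or_ne i j with rfl | hij
    · simpa [h00] using hdiag i 0
    · exact hoff i j hij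
  have hle : Ideal.span (Set.range f) ≤ Ideal.span {d * p} := by
    rw [Ideal.span_le]
    rintro _ ⟨x, rfl⟩
    rw [SetLike.mem_coe, Ideal.mem_span_singleton]
    change _ ∣ (A - A 0 0 • 1) x.1 x.2
    rw [hA']
    exact mul_dvd_mul_left d (hp _ _)
  rw [hd, Ideal.span_singleton_le_span_singleton] at hle
  exact isUnit_of_dvd_one ((mul_dvd_mul_iff_left hd0).1 (by rwa [mul_one]))

end Core

end Matrix

/-- **Theorem (Laffey–Reams normal form over a PID).**
Every non-scalar `n × n` matrix (`n ≥ 3`, encoded as `n + 3`) over a PID is similar to a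
matrix `B` with `B 0 1 ∣ B i j` for `i ≠ j`, `B 0 1 ∣ B i i - B j j`, and `B i j = 0`
whenever `j ≥ i + 2`. -/
theorem laffey_reams_normal_form {R : Type*} [CommRing R] [IsDomain R]
    [IsPrincipalIdealRing R] {n : ℕ}
    (A : Matrix (Fin (n + 3)) (Fin (n + 3)) R)
    (hA : ∀ c : R, A ≠ c • (1 : Matrix (Fin (n + 3)) (Fin (n + 3)) R)) :
    ∃ B : Matrix (Fin (n + 3)) (Fin (n + 3)) R,
      (∃ g : (Matrix (Fin (n + 3)) (Fin (n + 3)) R)ˣ, B = (g : Matrix (Fin (n + 3)) (Fin (n + 3)) R) * A * (↑g⁻¹ : Matrix (Fin (n + 3)) (Fin (n + 3)) R)) ∧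
      (∀ i j, i ≠ j → B 0 1 ∣ B i j) ∧
      (∀ i j, B 0 1 ∣ (B i i - B j j)) ∧
      (∀ i j : Fin (n + 3), (i : ℕ) + 2 ≤ (j : ℕ) → B i j = 0) := by
  obtain ⟨a, d, A', rfl, hA'⟩ := Matrix.exists_eq_smul_one_add_smul hA
  obtain ⟨v, hv⟩ := hA'.hasNoneigenvector
  obtain ⟨g, hess, hg⟩ := Matrix.exists_conjBy_hessenberg A' v
  have hunit := hv _ (hg _ dvd_rfl)
  have hB : Matrix.conjBy g (a • 1 + d • A') = a • 1 + d • Matrix.conjBy g A' := by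
    simp [Matrix.conjBy, Matrix.mul_add, Matrix.add_mul]
  have h01 : (a • 1 + d • Matrix.conjBy g A') 0 1 = d * Matrix.conjBy g A' 0 1 := by simp
  have hdvd : ∀ x, (a • 1 + d • Matrix.conjBy g A') 0 1 ∣ d * x := fun x => by
    rw [h01]
    exact mul_dvd_mul_left d hunit.dvd
  refine ⟨_, ⟨g⁻¹, rfl⟩, ?_⟩
  rw [inv_inv]
  change (∀ i j, i ≠ j → Matrix.conjBy g (a • 1 + d • A') 0 1 ∣
      Matrix.conjBy g (a • 1 + d • A') i j) ∧
    (∀ i j, Matrix.conjBy g (a • 1 + d • A') 0 1 ∣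
      Matrix.conjBy g (a • 1 + d • A') i i - Matrix.conjBy g (a • 1 + d • A') j j) ∧
    ∀ i j : Fin (n + 3), (i : ℕ) + 2 ≤ j → Matrix.conjBy g (a • 1 + d • A') i j = 0
  rw [hB]
  refine ⟨fun i j hij => ?_, fun i j => ?_, fun i j hij => ?_⟩
  · simpa [hij] using hdvd (Matrix.conjBy g A' i j)
  · simpa [mul_sub] using hdvd (Matrix.conjBy g A' i i - Matrix.conjBy g A' j j)
  · have hne : i ≠ j := by rintro rfl; omega
    simp [hne, hess i j hij]
end

section
/- Let R be a principal ideal domain and let A be a non-scalar 3×3 matrix over R. Then A is similar to a matrix B = (b_ij) over R such that b_12 divides b_ij for all i ≠ j and b_12 divides b_ii − b_jj for all 1 ≤ i, j ≤ 3. -/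
open Matrix

/-- `m` is minimal for divisibility among the values `u B v` with `u ⬝ v = 0`. -/
def Matrix.IsMinimalValue {n R : Type*} [Fintype n] [CommRing R] (B : Matrix n n R) (m : R) :
    Prop :=
  ∀ u v : n → R, u ⬝ᵥ v = 0 → u ⬝ᵥ B *ᵥ v ∣ m → m ∣ u ⬝ᵥ B *ᵥ v

theorem exists_eq_smul_and_dotProduct_eq {ι R : Type*} [Fintype ι] [CommRing R]
    [IsPrincipalIdealRing R] (f : ι → R) :
    ∃ (δ : R) (f' x : ι → R), f = δ • f' ∧ x ⬝ᵥ f = δ := by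
  obtain ⟨δ, hδ⟩ := (IsPrincipalIdealRing.principal (Ideal.span (Set.range f))).principal
  rw [← Ideal.span] at hδ
  have h1 : ∀ i, δ ∣ f i := fun i => by
    rw [← Ideal.mem_span_singleton, ← hδ]
    exact Ideal.subset_span ⟨i, rfl⟩
  have h2 : δ ∈ Ideal.span (Set.range f) := hδ ▸ Ideal.mem_span_singleton_self δ
  choose f' hf' using h1
  obtain ⟨x, hx⟩ := Ideal.mem_span_range_iff_exists_fun.1 h2
  exact ⟨δ, f', x, funext hf', hx⟩

namespace Matrix.IsMinimalValue

theorem conj {n R : Type*} [Fintype n] [DecidableEq n] [CommRing R] {B : Matrix n n R} {m : R}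
    (hB : B.IsMinimalValue m) (g : (Matrix n n R)ˣ) :
    ((g : Matrix n n R) * B * (↑g⁻¹ : Matrix n n R)).IsMinimalValue m := by
  intro u v huv
  have h := hB (u ᵥ* (g : Matrix n n R)) ((↑g⁻¹ : Matrix n n R) *ᵥ v)
    (by rw [← dotProduct_mulVec, mulVec_mulVec, Units.mul_inv, one_mulVec, huv])
  simpa only [← dotProduct_mulVec, mulVec_mulVec, Matrix.mul_assoc] using h

theorem transpose {n R : Type*} [Fintype n] [CommRing R] {B : Matrix n n R} {m : R}
    (hB : B.IsMinimalValue m) : Bᵀ.IsMinimalValue m := by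
  intro u v huv
  have h := hB v u (by rwa [dotProduct_comm])
  rwa [dotProduct_mulVec, ← mulVec_transpose, dotProduct_comm] at h

theorem submatrix {n R : Type*} [Fintype n] [CommRing R] {B : Matrix n n R} {m : R}
    (hB : B.IsMinimalValue m) (σ : n ≃ n) : (B.submatrix σ σ).IsMinimalValue m := by
  intro u v huv
  have h := hB (u ∘ σ.symm) (v ∘ σ.symm) (by rwa [dotProduct_comp_equiv_symm, Function.comp_assoc,
    Equiv.symm_comp_self, Function.comp_id])
  rwa [← comp_equiv_dotProduct_comp_equiv _ _ σ, Function.comp_assoc, Equiv.symm_comp_self,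
    Function.comp_id, ← submatrix_mulVec_equiv] at h

theorem dvd_right {n R : Type*} [Fintype n] [CommRing R] [IsBezout R] {B : Matrix n n R}
    {m : R} (hB : B.IsMinimalValue m) {u v v' : n → R} (huv : u ⬝ᵥ v = 0)
    (hm : u ⬝ᵥ B *ᵥ v = m) (huv' : u ⬝ᵥ v' = 0) : m ∣ u ⬝ᵥ B *ᵥ v' := by
  obtain ⟨x, y, hxy⟩ := IsBezout.gcd_eq_sum m (u ⬝ᵥ B *ᵥ v')
  have h := hB u (x • v + y • v') (by simp [huv, huv'])
  have e : u ⬝ᵥ B *ᵥ (x • v + y • v') = IsBezout.gcd m (u ⬝ᵥ B *ᵥ v') := by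
    rw [← hxy]; simp [mulVec_add, mulVec_smul, hm]
  rw [e] at h
  exact (h (IsBezout.gcd_dvd_left _ _)).trans (IsBezout.gcd_dvd_right _ _)

theorem dvd_left {n R : Type*} [Fintype n] [CommRing R] [IsBezout R] {B : Matrix n n R}
    {m : R} (hB : B.IsMinimalValue m) {u u' v : n → R} (huv : u ⬝ᵥ v = 0)
    (hm : u ⬝ᵥ B *ᵥ v = m) (huv' : u' ⬝ᵥ v = 0) : m ∣ u' ⬝ᵥ B *ᵥ v := by
  have key : ∀ w, v ⬝ᵥ Bᵀ *ᵥ w = w ⬝ᵥ B *ᵥ v := fun w => by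
    rw [mulVec_transpose, dotProduct_comm, dotProduct_mulVec]
  have h := hB.transpose.dvd_right (u := v) (v := u) (v' := u') (by rwa [dotProduct_comm])
    (by rw [key, hm]) (by rwa [dotProduct_comm])
  rwa [key] at h

theorem exists_dotProduct_eq_one {n R : Type*} [Fintype n] [CommRing R] [IsDomain R]
    [IsPrincipalIdealRing R] {B : Matrix n n R} {m : R} (hB : B.IsMinimalValue m) (hm : m ≠ 0)
    {u v : n → R} (huv : u ⬝ᵥ v = 0) (huBv : u ⬝ᵥ B *ᵥ v = m) : ∃ x, u ⬝ᵥ x = 1 := by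
  obtain ⟨δ, u', x, rfl, hx⟩ := exists_eq_smul_and_dotProduct_eq u
  simp only [smul_dotProduct, smul_eq_mul] at huv huBv
  have hδ : δ ≠ 0 := by rintro rfl; simp at huBv; exact hm huBv.symm
  obtain ⟨k, hk⟩ := hB u' v ((mul_eq_zero.1 huv).resolve_left hδ) ⟨δ, by rw [mul_comm, huBv]⟩
  refine ⟨k • x, ?_⟩
  rw [dotProduct_smul, dotProduct_comm, hx, smul_eq_mul]
  refine mul_left_cancel₀ hm ?_
  rw [hk] at huBv
  linear_combination huBv

variable {R : Type*} [CommRing R]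

/-- A minimal value is the `(0, 1)` entry of a conjugate matrix. -/
theorem exists_conj [IsDomain R] [IsPrincipalIdealRing R] {B : Matrix (Fin 3) (Fin 3) R} {m : R}
    (hB : B.IsMinimalValue m) (hm : m ≠ 0) {u v : Fin 3 → R} (huv : u ⬝ᵥ v = 0)
    (huBv : u ⬝ᵥ B *ᵥ v = m) :
    ∃ g : (Matrix (Fin 3) (Fin 3) R)ˣ,
      ((g : Matrix (Fin 3) (Fin 3) R) * B * (↑g⁻¹ : Matrix (Fin 3) (Fin 3) R)) 0 1 = m := by
  obtain ⟨x, hx⟩ := hB.exists_dotProduct_eq_one hm huv huBv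
  obtain ⟨y₀, hy₀⟩ := hB.transpose.exists_dotProduct_eq_one hm (u := v) (v := u)
    (by rwa [dotProduct_comm])
    (by rwa [mulVec_transpose, dotProduct_comm, ← dotProduct_mulVec])
  obtain ⟨y, hyv, hyx⟩ : ∃ y, y ⬝ᵥ v = 1 ∧ y ⬝ᵥ x = 0 := by
    refine ⟨y₀ - (y₀ ⬝ᵥ x) • u, ?_, ?_⟩
    · rw [sub_dotProduct, smul_dotProduct, huv, dotProduct_comm, hy₀, smul_zero, sub_zero]
    · rw [sub_dotProduct, smul_dotProduct, hx, smul_eq_mul, mul_one, sub_self]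
  let G : Matrix (Fin 3) (Fin 3) R := Matrix.of ![u, y, crossProduct x v]
  let H : Matrix (Fin 3) (Fin 3) R := (Matrix.of ![x, v, crossProduct u y])ᵀ
  have hGH : G * H = 1 := by
    have key : ∀ i j, (G * H) i j =
        (![u, y, crossProduct x v] i) ⬝ᵥ (![x, v, crossProduct u y] j) := fun i j => rfl
    ext i j
    rw [key]
    fin_cases i <;> fin_cases j
    · simpa using hx
    · simpa using huv
    · simp
    · simpa using hyx
    · simpa using hyv
    · simp
    · simp [dotProduct_comm _ x]
    · simp [dotProduct_comm _ v]
    · simp [cross_dot_cross, dotProduct_comm x, dotProduct_comm v, hx, hyv, huv]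
  refine ⟨⟨G, H, hGH, mul_eq_one_comm.1 hGH⟩, ?_⟩
  rw [← huBv, Units.inv_mk, Matrix.mul_assoc]
  rfl

theorem dvd_sq [IsBezout R] {m a c d e f h : R}
    (hB : (!![a, m, 0; c, d, e; f, 0, h] : Matrix (Fin 3) (Fin 3) R).IsMinimalValue m) :
    m ∣ h - d - e ∧ m ∣ h - a - f ∧ m ∣ e ^ 2 ∧ ∃ k, m ∣ k * (a - d) + c - f := by
  have hr := fun u₀ u₁ u₂ v₀ v₁ v₂ w₀ w₁ w₂ =>
    hB.dvd_right (u := ![u₀, u₁, u₂]) (v := ![v₀, v₁, v₂]) (v' := ![w₀, w₁, w₂])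
  have hl := hB.dvd_left (u := ![1, 0, 0]) (v := ![0, 1, 1]) (u' := ![0, -1, 1])
  simp [Matrix.mulVec, dotProduct, Fin.sum_univ_three] at hr hl
  have hde : m ∣ h - d - e := by
    convert hl using 1; ring
  have haf : m ∣ h - a - f := by
    convert hr 1 0 1 0 1 0 (-1) 0 1 (by ring) (by ring) (by ring) using 1; ring
  have haf' : m ∣ h - a + f := by
    rw [← dvd_neg]
    convert hr 1 0 (-1) 0 1 0 1 0 1 (by ring) (by ring) (by ring) using 1; ring
  obtain ⟨α, hα⟩ := hde
  obtain ⟨x, hx⟩ := haf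
  obtain ⟨x', hx'⟩ := haf'
  obtain rfl : h = d + e + m * α := by linear_combination hα
  obtain ⟨y, hy⟩ := hr (1 + α) 1 (-1) 0 1 1 1 (-(1 + α)) 0 (by ring) (by ring) (by ring)
  obtain ⟨z, hz⟩ := hr (1 + (1 + m) * (α - e)) (1 + m) (-1) 0 1 (1 + m)
    (1 + m) (-(1 + (1 + m) * (α - e))) 0 (by ring) (by ring) (by ring)
  obtain ⟨w, hw⟩ := hr (1 + (e + m * α - m * e)) m (-1) 0 1 m
    1 0 (1 + (e + m * α - m * e)) (by ring) (by ring) (by ring)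
  have hk : m ∣ (1 + α) * (a - d) + c - f := ⟨y + (1 + α) ^ 2, by linear_combination hy⟩
  refine ⟨⟨α, by ring⟩, ⟨x, hx⟩, ?_, 1 + α, hk⟩
  rw [← Ideal.Quotient.eq_zero_iff_dvd] at hk ⊢
  have hm : Ideal.Quotient.mk (Ideal.span {m}) m = 0 := by
    rw [Ideal.Quotient.eq_zero_iff_dvd]
  apply_fun Ideal.Quotient.mk (Ideal.span {m}) at hx hx' hz hw
  simp only [map_add, map_sub, map_mul, map_neg, map_one, map_pow, map_zero, hm] at hx hx' hz hw hk ⊢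
  generalize Ideal.Quotient.mk (Ideal.span {m}) a = a at *
  generalize Ideal.Quotient.mk (Ideal.span {m}) c = c at *
  generalize Ideal.Quotient.mk (Ideal.span {m}) d = d at *
  generalize Ideal.Quotient.mk (Ideal.span {m}) e = e at *
  generalize Ideal.Quotient.mk (Ideal.span {m}) f = f at *
  generalize Ideal.Quotient.mk (Ideal.span {m}) α = α at *
  have hef : e * f = 0 := by grind
  have hed : e * (d - a) = 0 := by grind
  grind

theorem exists_conj_eq_zero [IsBezout R] {B : Matrix (Fin 3) (Fin 3) R}
    (hB : B.IsMinimalValue (B 0 1)) :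
    ∃ g : (Matrix (Fin 3) (Fin 3) R)ˣ, ∃ a c d e f h,
      (g : Matrix (Fin 3) (Fin 3) R) * B * (↑g⁻¹ : Matrix (Fin 3) (Fin 3) R) =
        !![a, B 0 1, 0; c, d, e; f, 0, h] := by
  obtain ⟨k, hk⟩ := hB.dvd_right (u := ![1, 0, 0]) (v := ![0, 1, 0]) (v' := ![0, 0, 1])
    (by simp) (by simp [mulVec, dotProduct, Fin.sum_univ_three]) (by simp)
  obtain ⟨l, hl⟩ := hB.dvd_left (u := ![1, 0, 0]) (v := ![0, 1, 0]) (u' := ![0, 0, 1])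
    (by simp) (by simp [mulVec, dotProduct, Fin.sum_univ_three]) (by simp)
  simp [mulVec, dotProduct, Fin.sum_univ_three] at hk hl
  have hGH : !![1, 0, 0; 0, 1, k; -l, 0, 1] * !![1, 0, 0; -(k * l), 1, -k; l, 0, 1] =
      (1 : Matrix (Fin 3) (Fin 3) R) := by
    ext i j
    fin_cases i <;> fin_cases j <;> simp [Matrix.mul_apply, Fin.sum_univ_three, mul_comm]
  let g : (Matrix (Fin 3) (Fin 3) R)ˣ := ⟨_, _, hGH, mul_eq_one_comm.1 hGH⟩
  let C := (g : Matrix (Fin 3) (Fin 3) R) * B * (↑g⁻¹ : Matrix (Fin 3) (Fin 3) R)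
  refine ⟨g, C 0 0, C 1 0, C 1 1, C 1 2, C 2 0, C 2 2, ?_⟩
  have h01 : C 0 1 = B 0 1 := by
    simp only [C, g, Units.inv_mk, Matrix.mul_apply, Fin.sum_univ_three]
    simp
  have h02 : C 0 2 = 0 := by
    simp only [C, g, Units.inv_mk, Matrix.mul_apply, Fin.sum_univ_three]
    simp [hk]
  have h21 : C 2 1 = 0 := by
    simp only [C, g, Units.inv_mk, Matrix.mul_apply, Fin.sum_univ_three]
    simp [hl, mul_comm]
  change C = _
  ext i j
  fin_cases i <;> fin_cases j <;> simp [h01, h02, h21]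

/-- Modulo a prime divisor of a nonzero minimal value, the matrix is scalar. -/
theorem dvd_of_prime [IsDomain R] [IsPrincipalIdealRing R] {B : Matrix (Fin 3) (Fin 3) R} {m : R}
    (hB : B.IsMinimalValue m) (hm : m ≠ 0) {u₀ v₀ : Fin 3 → R} (huv₀ : u₀ ⬝ᵥ v₀ = 0)
    (huBv₀ : u₀ ⬝ᵥ B *ᵥ v₀ = m) {p : R} (hp : Prime p) (hpm : p ∣ m) {u v : Fin 3 → R}
    (huv : u ⬝ᵥ v = 0) : p ∣ u ⬝ᵥ B *ᵥ v := by
  obtain ⟨g₁, hg₁⟩ := hB.exists_conj hm huv₀ huBv₀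
  have hB₁ := hB.conj g₁
  rw [← hg₁] at hB₁
  obtain ⟨g₂, a, c, d, e, f, h, hg₂⟩ := hB₁.exists_conj_eq_zero
  have hB₂ := hB₁.conj g₂
  rw [hg₂, hg₁] at hB₂
  have hdual : (!![d, m, 0; c, a, f; e, 0, h] : Matrix (Fin 3) (Fin 3) R).IsMinimalValue m := by
    convert hB₂.transpose.submatrix (Equiv.swap 0 1) using 1
    ext i j
    fin_cases i <;> fin_cases j <;> simp [Equiv.swap_apply_def]
  obtain ⟨hde, haf, he, k, hk⟩ := hB₂.dvd_sq
  obtain ⟨-, -, hf, -⟩ := hdual.dvd_sq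
  obtain ⟨e', rfl⟩ := hp.dvd_of_dvd_pow (hpm.trans he)
  obtain ⟨f', rfl⟩ := hp.dvd_of_dvd_pow (hpm.trans hf)
  obtain ⟨x, hx⟩ := hpm.trans hde
  obtain ⟨y, hy⟩ := hpm.trans haf
  obtain ⟨z, hz⟩ := hpm.trans hk
  obtain ⟨m', rfl⟩ := hpm
  have key : ∀ w w' : Fin 3 → R, w ⬝ᵥ w' = 0 →
      p ∣ w ⬝ᵥ !![a, p * m', 0; c, d, p * e'; p * f', 0, h] *ᵥ w' := by
    intro w w' hw
    simp only [dotProduct, mulVec, Fin.sum_univ_three] at hw ⊢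
    simp
    refine ⟨w 0 * m' * w' 1 + w 1 * (z + f' - k * (x + e' - y - f')) * w' 0
      + w 1 * e' * w' 2 + w 2 * f' * w' 0 - w 0 * (y + f') * w' 0 - w 1 * (x + e') * w' 1, ?_⟩
    linear_combination h * hw + w 1 * w' 0 * (hz - k * (hx - hy)) - w 0 * w' 0 * hy
      - w 1 * w' 1 * hx
  have hg : B = (↑(g₂ * g₁)⁻¹ : Matrix (Fin 3) (Fin 3) R) *
      !![a, p * m', 0; c, d, p * e'; p * f', 0, h] * ((g₂ * g₁ : (Matrix (Fin 3) (Fin 3) R)ˣ) :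
        Matrix (Fin 3) (Fin 3) R) := by
    rw [← hg₁, ← hg₂]
    simp [mul_assoc]
  have := key (u ᵥ* (↑(g₂ * g₁)⁻¹ : Matrix (Fin 3) (Fin 3) R))
    (((g₂ * g₁ : (Matrix (Fin 3) (Fin 3) R)ˣ) : Matrix (Fin 3) (Fin 3) R) *ᵥ v)
    (by rw [← dotProduct_mulVec, mulVec_mulVec, Units.inv_mul, one_mulVec, huv])
  rw [hg]
  simpa only [← dotProduct_mulVec, mulVec_mulVec, Matrix.mul_assoc] using this

end Matrix.IsMinimalValue

/-- If all values `u N v` with `u ⬝ v = 0` are divisible by `p`, then `N` is scalar modulo `p`. -/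
theorem Matrix.dvd_sub_scalar_of_forall_dvd {n R : Type*} [Fintype n] [DecidableEq n] [CommRing R]
    {N : Matrix n n R} {p : R} (h : ∀ u v : n → R, u ⬝ᵥ v = 0 → p ∣ u ⬝ᵥ N *ᵥ v) (k i j : n) :
    p ∣ (N - N k k • (1 : Matrix n n R)) i j := by
  have hoff : ∀ i j, i ≠ j → p ∣ N i j := fun i j hij => by
    simpa [mulVec_single_one] using h (Pi.single i 1) (Pi.single j 1) (by simp [hij])
  by_cases hij : i = j
  · subst hij
    by_cases hik : i = k
    · simp [hik]
    have := h (Pi.single i 1 + Pi.single k 1) (Pi.single i 1 - Pi.single k 1)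
      (by simp [hik, Ne.symm hik])
    simp [mulVec_sub] at this
    have h2 := (this.add (hoff i k hik)).sub (hoff k i (Ne.symm hik))
    simp
    convert h2 using 1
    ring
  · simpa [hij] using hoff i j hij

/-- A `3 × 3` matrix over a principal ideal domain that is not scalar modulo any prime is similar
to one whose `(0, 1)` entry is a unit. -/
theorem Matrix.exists_conj_isUnit {R : Type*} [CommRing R] [IsDomain R] [IsPrincipalIdealRing R]
    {N : Matrix (Fin 3) (Fin 3) R} (h0 : ∃ u v : Fin 3 → R, u ⬝ᵥ v = 0 ∧ u ⬝ᵥ N *ᵥ v ≠ 0)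
    (hN : ∀ p, Prime p → ¬ ∀ u v : Fin 3 → R, u ⬝ᵥ v = 0 → p ∣ u ⬝ᵥ N *ᵥ v) :
    ∃ g : (Matrix (Fin 3) (Fin 3) R)ˣ,
      IsUnit (((g : Matrix (Fin 3) (Fin 3) R) * N * (↑g⁻¹ : Matrix (Fin 3) (Fin 3) R)) 0 1) := by
  obtain ⟨u₀, v₀, huv₀, hne₀⟩ := h0
  obtain ⟨m, ⟨hm, u, v, huv, huNv⟩, hmin⟩ := (wellFounded_dvdNotUnit (α := R)).has_min
    {m : R | m ≠ 0 ∧ ∃ u v : Fin 3 → R, u ⬝ᵥ v = 0 ∧ u ⬝ᵥ N *ᵥ v = m}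
    ⟨_, hne₀, u₀, v₀, huv₀, rfl⟩
  have hB : N.IsMinimalValue m := fun u v huv hd => by
    by_contra hnd
    exact hmin _ ⟨ne_zero_of_dvd_ne_zero hm hd, u, v, huv, rfl⟩ (dvdNotUnit_of_dvd_of_not_dvd hd hnd)
  obtain ⟨g, hg⟩ := hB.exists_conj hm huv huNv
  refine ⟨g, hg ▸ ?_⟩
  by_contra hu
  obtain ⟨p, hp, hpm⟩ := WfDvdMonoid.exists_irreducible_factor hu hm
  exact hN p hp.prime fun _ _ => hB.dvd_of_prime hm huv huNv hp.prime hpm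

/-- **Proposition (3×3 normal form over a PID).**
Every non-scalar `3 × 3` matrix over a PID is similar to a matrix `B` such that `B 0 1`
divides every off-diagonal entry and every difference of diagonal entries. -/
theorem laffey_reams_normal_form_three {R : Type*} [CommRing R] [IsDomain R]
    [IsPrincipalIdealRing R]
    (A : Matrix (Fin 3) (Fin 3) R)
    (hA : ∀ c : R, A ≠ c • (1 : Matrix (Fin 3) (Fin 3) R)) :
    ∃ B : Matrix (Fin 3) (Fin 3) R,
      (∃ g : (Matrix (Fin 3) (Fin 3) R)ˣ,
        B = (g : Matrix (Fin 3) (Fin 3) R) * A * (↑g⁻¹ : Matrix (Fin 3) (Fin 3) R)) ∧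
      (∀ i j, i ≠ j → B 0 1 ∣ B i j) ∧
      (∀ i j, B 0 1 ∣ (B i i - B j j)) := by
  obtain ⟨d, N', x, hN', hx⟩ := exists_eq_smul_and_dotProduct_eq
    fun q : Fin 3 × Fin 3 => (A - A 0 0 • (1 : Matrix (Fin 3) (Fin 3) R)) q.1 q.2
  let N : Matrix (Fin 3) (Fin 3) R := Matrix.of fun i j => N' (i, j)
  have hAN : A = A 0 0 • (1 : Matrix (Fin 3) (Fin 3) R) + d • N := by
    ext i j
    have := congrFun hN' (i, j)
    simpa [N, sub_eq_iff_eq_add'] using this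
  have hd : d ≠ 0 := by
    rintro rfl
    exact hA (A 0 0) (by simpa using hAN)
  have hN00 : N 0 0 = 0 := by
    have := congrFun (congrFun hAN 0) 0
    simpa [hd] using this
  have hxN : x ⬝ᵥ N' = 1 := by
    rw [hN', dotProduct_smul, smul_eq_mul] at hx
    exact mul_left_cancel₀ hd (by rw [hx, mul_one])
  have hunit : ∀ p, (∀ u v : Fin 3 → R, u ⬝ᵥ v = 0 → p ∣ u ⬝ᵥ N *ᵥ v) → IsUnit p := by
    intro p hp
    rw [isUnit_iff_dvd_one, ← hxN]
    refine Finset.dvd_sum fun q _ => Dvd.dvd.mul_left ?_ _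
    simpa [hN00, N] using dvd_sub_scalar_of_forall_dvd hp 0 q.1 q.2
  obtain ⟨g, hg⟩ := exists_conj_isUnit (N := N)
    (by
      by_contra! h
      exact not_isUnit_zero (hunit 0 fun u v huv => by rw [h u v huv]))
    fun p hp h => hp.not_isUnit (hunit p h)
  let C := (g : Matrix (Fin 3) (Fin 3) R) * N * (↑g⁻¹ : Matrix (Fin 3) (Fin 3) R)
  have hB : (g : Matrix (Fin 3) (Fin 3) R) * A * (↑g⁻¹ : Matrix (Fin 3) (Fin 3) R) =
      A 0 0 • (1 : Matrix (Fin 3) (Fin 3) R) + d • C := by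
    conv_lhs => rw [hAN]
    simp [C, Matrix.mul_add, Matrix.add_mul]
  have h01 : ∀ t, (A 0 0 • (1 : Matrix (Fin 3) (Fin 3) R) + d • C) 0 1 ∣ d * t := fun t => by
    have : IsUnit (C 0 1) := hg
    have h : d * C 0 1 ∣ d * t := mul_dvd_mul_left d this.dvd
    simpa using h
  refine ⟨_, ⟨g, rfl⟩, fun i j hij => ?_, fun i j => ?_⟩
  · rw [hB]
    simpa [hij] using h01 (C i j)
  · rw [hB]
    simpa [mul_sub] using h01 (C i i - C j j)
end

section
/- Let R be a principal ideal domain, let A be a non-scalar n×n matrix over R, and let S be a finite set of maximal ideals of R such that the reduction of A modulo p is non-scalar over R/p for every p ∈ S. Then A is similar over R to a matrix B = (b_ij) such that b_12 ∉ p for all p ∈ S. -/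
section CongruentConjugation

open Matrix

variable {R ι : Type*} [CommRing R] [Fintype ι] [DecidableEq ι]

/-- `B` is conjugate to `A` by an invertible matrix, and `B` is entrywise congruent to `A`
modulo `e`. -/
def CongrConj (e : R) (A B : Matrix ι ι R) : Prop :=
  (∃ g : (Matrix ι ι R)ˣ, B = (g : Matrix ι ι R) * A * (↑g⁻¹ : Matrix ι ι R)) ∧
    ∀ i j, e ∣ B i j - A i j

theorem CongrConj.refl (e : R) (A : Matrix ι ι R) : CongrConj e A A :=
  ⟨⟨1, by simp⟩, by simp⟩

theorem CongrConj.trans {e : R} {A B C : Matrix ι ι R} (h : CongrConj e A B)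
    (h' : CongrConj e B C) : CongrConj e A C := by
  obtain ⟨⟨g, rfl⟩, hg⟩ := h
  obtain ⟨⟨k, rfl⟩, hk⟩ := h'
  refine ⟨⟨k * g, by simp [mul_assoc]⟩, fun i j => ?_⟩
  simpa using dvd_add (hk i j) (hg i j)

theorem transvection_conj_apply (A : Matrix ι ι R) (i j : ι) (c : R) (k l : ι) :
    (transvection i j c * A * transvection i j (-c)) k l =
      A k l + (if k = i then c * A j l else 0) - (if l = j then c * A k i else 0) -
        (if k = i ∧ l = j then c ^ 2 * A j i else 0) := by
  by_cases hk : k = i <;> by_cases hl : l = j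
  · subst hk hl; simp; ring
  · subst hk; simp [hl]
  · subst hl; simp [hk]; ring
  · simp [hk, hl]

theorem congrConj_transvection (e : R) (A : Matrix ι ι R) {i j : ι} (h : i ≠ j) :
    CongrConj e A (transvection i j e * A * transvection i j (-e)) := by
  refine ⟨⟨⟨transvection i j e, transvection i j (-e), ?_, ?_⟩, rfl⟩, fun k l => ?_⟩
  · simp [transvection_mul_transvection_same, h]
  · simp [transvection_mul_transvection_same, h]
  · rw [transvection_conj_apply]
    refine ⟨(if k = i then A j l else 0) - (if l = j then A k i else 0) -
      (if k = i ∧ l = j then e * A j i else 0), ?_⟩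
    split_ifs <;> ring

variable {p : Ideal R} {e : R}

theorem exists_congrConj_notMem_same_row (hp : p.IsPrime) (he : e ∉ p) {A : Matrix ι ι R}
    {i j k : ι} (hij : i ≠ j) (hik : i ≠ k) (h : A i j ∉ p) :
    ∃ B, CongrConj e A B ∧ B i k ∉ p := by
  by_cases hk : A i k ∈ p
  · have hjk : j ≠ k := by rintro rfl; exact h hk
    refine ⟨_, congrConj_transvection e A hjk, fun hB => ?_⟩
    rw [transvection_conj_apply] at hB
    simp only [hij, if_false, if_true, false_and, add_zero, sub_zero] at hB
    exact (hp.mem_or_mem ((p.sub_mem_iff_right hk).1 hB)).elim he h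
  · exact ⟨A, .refl e A, hk⟩

theorem exists_congrConj_notMem_same_col (hp : p.IsPrime) (he : e ∉ p) {A : Matrix ι ι R}
    {i j k : ι} (hij : i ≠ j) (h : A i j ∉ p) :
    ∃ B, CongrConj e A B ∧ B k j ∉ p := by
  by_cases hk : A k j ∈ p
  · have hki : k ≠ i := by rintro rfl; exact h hk
    refine ⟨_, congrConj_transvection e A hki, fun hB => ?_⟩
    rw [transvection_conj_apply] at hB
    simp only [hij.symm, if_false, if_true, and_false, sub_zero] at hB
    exact (hp.mem_or_mem ((p.add_mem_iff_right hk).1 hB)).elim he h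
  · exact ⟨A, .refl e A, hk⟩

theorem exists_congrConj_notMem_swap (hp : p.IsPrime) (he : e ∉ p) {A : Matrix ι ι R}
    {i j : ι} (hij : i ≠ j) (h : A j i ∉ p) :
    ∃ B, CongrConj e A B ∧ B i j ∉ p := by
  by_contra! H
  have h0 := H A (.refl e A)
  have h1 := H _ (congrConj_transvection e A hij)
  have h2 := H _ ((congrConj_transvection e A hij.symm).trans (congrConj_transvection e _ hij))
  rw [transvection_conj_apply] at h1 h2
  simp only [transvection_conj_apply, hij, hij.symm, if_true, if_false, and_self, and_false,
    false_and, add_zero, sub_zero] at h1 h2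
  have key : e * (e * (e * (e * A j i))) ∈ p := by
    rw [← Ideal.Quotient.eq_zero_iff_mem] at h0 h1 h2 ⊢
    simp only [map_add, map_sub, map_mul, map_pow, h0] at h1 h2 ⊢
    grind
  have := fun x (hx : e * x ∈ p) => (hp.mem_or_mem hx).resolve_left he
  exact h (this _ (this _ (this _ (this _ key))))

theorem exists_congrConj_notMem_of_offDiag (hp : p.IsPrime) (he : e ∉ p) {A : Matrix ι ι R}
    {i j k l : ι} (hij : i ≠ j) (hkl : k ≠ l) (h : A i j ∉ p) :
    ∃ B, CongrConj e A B ∧ B k l ∉ p := by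
  by_cases hkj : k = j
  · subst hkj
    by_cases hil : i = l
    · subst hil
      exact exists_congrConj_notMem_swap hp he hkl h
    · obtain ⟨B, hB, hBil⟩ := exists_congrConj_notMem_same_row hp he hij hil h
      obtain ⟨C, hC, hCkl⟩ := exists_congrConj_notMem_same_col hp he hil hBil
      exact ⟨C, hB.trans hC, hCkl⟩
  · obtain ⟨B, hB, hBkj⟩ := exists_congrConj_notMem_same_col hp he hij h
    obtain ⟨C, hC, hCkl⟩ := exists_congrConj_notMem_same_row hp he hkj hkl hBkj
    exact ⟨C, hB.trans hC, hCkl⟩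

theorem exists_congrConj_notMem (hp : p.IsPrime) (he : e ∉ p) {A : Matrix ι ι R}
    (hA : ∀ c : R ⧸ p, A.map (Ideal.Quotient.mk p) ≠ c • (1 : Matrix ι ι (R ⧸ p)))
    {k l : ι} (hkl : k ≠ l) : ∃ B, CongrConj e A B ∧ B k l ∉ p := by
  by_cases hoff : ∃ i j, i ≠ j ∧ A i j ∉ p
  · obtain ⟨i, j, hij, h⟩ := hoff
    exact exists_congrConj_notMem_of_offDiag hp he hij hkl h
  push Not at hoff
  obtain ⟨i, hi⟩ : ∃ i, A i i - A k k ∉ p := by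
    by_contra! H
    refine hA (Ideal.Quotient.mk p (A k k)) ?_
    ext i j
    by_cases hij : i = j
    · subst hij
      simpa using Ideal.Quotient.eq.2 (H i)
    · simpa [hij] using Ideal.Quotient.eq_zero_iff_mem.2 (hoff i j hij)
  have hki : k ≠ i := by rintro rfl; simp at hi
  have hB : (transvection k i e * A * transvection k i (-e)) k i ∉ p := fun hB => by
    simp only [transvection_conj_apply, if_true, and_self] at hB
    have h1 := p.add_mem (p.sub_mem hB (hoff k i hki)) (p.mul_mem_left (e ^ 2) (hoff i k hki.symm))
    refine (hp.mem_or_mem (show e * (A i i - A k k) ∈ p from ?_)).elim he hi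
    convert h1 using 1
    ring
  obtain ⟨C, hC, hCkl⟩ := exists_congrConj_notMem_of_offDiag hp he hki hkl hB
  exact ⟨C, (congrConj_transvection e A hki).trans hC, hCkl⟩

theorem map_conj_ne_smul_one {S : Type*} [CommRing S] (f : R →+* S) {A : Matrix ι ι R}
    (hA : ∀ c : S, A.map f ≠ c • (1 : Matrix ι ι S)) (g : (Matrix ι ι R)ˣ) (c : S) :
    ((g : Matrix ι ι R) * A * (↑g⁻¹ : Matrix ι ι R)).map f ≠ c • (1 : Matrix ι ι S) := by
  intro h
  refine hA c ?_
  have hAg : A = (↑g⁻¹ : Matrix ι ι R) * (g * A * (↑g⁻¹ : Matrix ι ι R)) * g := by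
    simp [mul_assoc]
  rw [hAg, Matrix.map_mul, Matrix.map_mul, h, Matrix.mul_smul, Matrix.smul_mul, mul_one,
    ← Matrix.map_mul, Units.inv_mul, Matrix.map_one f (map_zero f) (map_one f)]

/-- Conjugation can make a given off-diagonal entry avoid finitely many maximal ideals modulo
which the matrix is non-scalar, over any commutative ring. -/
theorem exists_conj_notMem_of_isMaximal (A : Matrix ι ι R) {k l : ι} (hkl : k ≠ l)
    (S : Finset (Ideal R)) (hS : ∀ p ∈ S, p.IsMaximal)
    (hA : ∀ p ∈ S, ∀ c : R ⧸ p,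
      A.map (Ideal.Quotient.mk p) ≠ c • (1 : Matrix ι ι (R ⧸ p))) :
    ∃ g : (Matrix ι ι R)ˣ,
      ∀ p ∈ S, ((g : Matrix ι ι R) * A * (↑g⁻¹ : Matrix ι ι R)) k l ∉ p := by
  classical
  induction S using Finset.induction_on with
  | empty => exact ⟨1, by simp⟩
  | insert p S hpS ih =>
    simp only [Finset.forall_mem_insert] at hS hA
    obtain ⟨g, hg⟩ := ih hS.2 hA.2
    have hp := hS.1.isPrime
    obtain ⟨e, heS, hep⟩ : ∃ e, (∀ q ∈ S, e ∈ q) ∧ e ∉ p := by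
      by_contra! H
      have hle : S.inf id ≤ p := fun x hx => H x fun q hq => (Finset.inf_le (f := id) hq) hx
      obtain ⟨q, hq, hqp⟩ := (Ideal.IsPrime.inf_le' hp).1 hle
      exact hpS ((hS.2 q hq).eq_of_le hp.ne_top hqp ▸ hq)
    obtain ⟨B, ⟨⟨u, rfl⟩, hcongr⟩, hB⟩ :=
      exists_congrConj_notMem hp hep (map_conj_ne_smul_one _ hA.1 g) hkl
    refine ⟨u * g, ?_⟩
    have hmul : ((u * g : (Matrix ι ι R)ˣ) : Matrix ι ι R) * A *
        (↑(u * g)⁻¹ : Matrix ι ι R) = u * (g * A * (↑g⁻¹ : Matrix ι ι R)) *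
          (↑u⁻¹ : Matrix ι ι R) := by
      simp [mul_assoc]
    rw [hmul, Finset.forall_mem_insert]
    refine ⟨hB, fun q hq hmem => hg q hq ?_⟩
    exact (q.sub_mem_iff_right hmem).1 (q.mem_of_dvd (hcongr k l) (heS q hq))

end CongruentConjugation


/-- **Lemma.** Let `R` be a PID, `A` a non-scalar `n × n` matrix (`n ≥ 2`, encoded as
`n + 2`), and `S` a finite set of maximal ideals of `R` such that `A` mod `p` is non-scalar
for each `p ∈ S`. Then `A` is similar to a matrix `B` with `B 0 1 ∉ p` for all `p ∈ S`. -/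
theorem similar_b12_avoids_primes {R : Type*} [CommRing R] [IsDomain R]
    [IsPrincipalIdealRing R] {n : ℕ}
    (A : Matrix (Fin (n + 2)) (Fin (n + 2)) R)
    (hA : ∀ c : R, A ≠ c • (1 : Matrix (Fin (n + 2)) (Fin (n + 2)) R))
    (S : Finset (Ideal R)) (hS : ∀ p ∈ S, p.IsMaximal)
    (hAp : ∀ p ∈ S, ∀ c : R ⧸ p,
      A.map (Ideal.Quotient.mk p) ≠ c • (1 : Matrix (Fin (n + 2)) (Fin (n + 2)) (R ⧸ p))) :
    ∃ B : Matrix (Fin (n + 2)) (Fin (n + 2)) R,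
      (∃ g : (Matrix (Fin (n + 2)) (Fin (n + 2)) R)ˣ,
        B = (g : Matrix (Fin (n + 2)) (Fin (n + 2)) R) * A * (↑g⁻¹ : Matrix (Fin (n + 2)) (Fin (n + 2)) R)) ∧
      ∀ p ∈ S, B 0 1 ∉ p := by
  obtain ⟨g, hg⟩ := exists_conj_notMem_of_isMaximal A Fin.zero_ne_one S hS hAp
  exact ⟨_, ⟨g, rfl⟩, hg⟩
end

section
/- Let R be a principal ideal domain, let A = (a_ij) be an n×n matrix over R with n ≥ 3, and fix an index u with 1 ≤ u ≤ n. Let r ∈ R be a generator of the ideal generated by the off-diagonal entries of row u, i.e. of (a_uj : 1 ≤ j ≤ n, j ≠ u). Then A is similar over R to a matrix B = (b_ij) whose row u has all off-diagonal entries zero except one, which equals r (specifically, if u = 1 then b_12 = r and b_1j = 0 for 3 ≤ j ≤ n; if u ≥ 2 then b_u1 = r and b_uj = 0 for all j ∉ {1, u}). -/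
/-- The automorphism of `ι → R` acting on the coordinates `p`, `q` by a matrix of determinant one
and fixing all other coordinates. -/
def planeEquiv {R ι : Type*} [CommRing R] [DecidableEq ι] {p q : ι} (hpq : p ≠ q)
    (x y z t : R) (h : x * t - y * z = 1) : (ι → R) ≃ₗ[R] (ι → R) where
  toFun v j := if j = p then x * v p + y * v q else if j = q then z * v p + t * v q else v j
  invFun v j := if j = p then t * v p - y * v q else if j = q then x * v q - z * v p else v j
  map_add' v w := by
    ext j
    simp only [Pi.add_apply]
    split_ifs <;> ring
  map_smul' c v := by
    ext j
    simp only [Pi.smul_apply, smul_eq_mul, RingHom.id_apply]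
    split_ifs <;> ring
  left_inv v := by
    ext j
    simp only [if_true, if_neg hpq.symm]
    split_ifs with h1 h2
    · subst h1; linear_combination v j * h
    · subst h2; linear_combination v j * h
    · rfl
  right_inv v := by
    ext j
    simp only [if_true, if_neg hpq.symm]
    split_ifs with h1 h2
    · subst h1; linear_combination v j * h
    · subst h2; linear_combination v j * h
    · rfl

theorem planeEquiv_apply {R ι : Type*} [CommRing R] [DecidableEq ι] {p q : ι} (hpq : p ≠ q)
    (x y z t : R) (h : x * t - y * z = 1) (v : ι → R) (j : ι) :
    planeEquiv hpq x y z t h v j =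
      if j = p then x * v p + y * v q else if j = q then z * v p + t * v q else v j :=
  rfl

/-- Over a Bézout domain, a pair can be moved to `(d, 0)` by a matrix of determinant one. -/
theorem IsBezout.exists_det_eq_one_and_eq_zero {R : Type*} [CommRing R] [IsDomain R] [IsBezout R]
    (a b : R) : ∃ x y z t : R, x * t - y * z = 1 ∧ z * a + t * b = 0 := by
  by_cases hd : IsBezout.gcd a b = 0
  · have hb : b = 0 := zero_dvd_iff.mp (hd ▸ IsBezout.gcd_dvd_right a b)
    exact ⟨1, 0, 0, 1, by ring, by rw [hb]; ring⟩
  · obtain ⟨x, y, hxy⟩ := IsBezout.gcd_eq_sum a b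
    obtain ⟨a', ha⟩ := IsBezout.gcd_dvd_left a b
    obtain ⟨b', hb⟩ := IsBezout.gcd_dvd_right a b
    generalize IsBezout.gcd a b = d at *
    refine ⟨x, y, -b', a', mul_left_cancel₀ hd ?_, ?_⟩
    · linear_combination hxy - x * ha - y * hb
    · rw [ha, hb]; ring

/-- A row can be cleared on a finite set of coordinates, against a pivot `p`, by an automorphism
fixing the basis vector at `u`. -/
theorem exists_linearEquiv_eq_zero_on {R ι : Type*} [CommRing R] [IsDomain R] [IsBezout R]
    [DecidableEq ι] {u p : ι} (hup : u ≠ p) (w : ι → R) (s : Finset ι) (hu : u ∉ s) (hp : p ∉ s) :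
    ∃ L : (ι → R) ≃ₗ[R] (ι → R), L (Pi.single u 1) = Pi.single u 1 ∧
      (∀ j ∈ s, L w j = 0) ∧ ∀ j ∉ s, j ≠ p → L w j = w j := by
  induction s using Finset.induction_on with
  | empty => exact ⟨LinearEquiv.refl R _, rfl, by simp, fun _ _ _ => rfl⟩
  | insert q s hq ih =>
    simp only [Finset.mem_insert, not_or] at hu hp
    obtain ⟨L, hLu, hLs, hLw⟩ := ih hu.2 hp.2
    obtain ⟨x, y, z, t, hdet, hzero⟩ := IsBezout.exists_det_eq_one_and_eq_zero (L w p) (L w q)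
    refine ⟨L.trans (planeEquiv hp.1 x y z t hdet), ?_, fun j hj => ?_, fun j hj hjp => ?_⟩
    · ext j
      rw [LinearEquiv.trans_apply, hLu, planeEquiv_apply]
      split_ifs with h1 h2
      · subst h1; simp [hup.symm, Ne.symm hu.1]
      · subst h2; simp [hup.symm, Ne.symm hu.1]
      · rfl
    · rw [LinearEquiv.trans_apply, planeEquiv_apply]
      rcases Finset.mem_insert.mp hj with rfl | hj
      · rw [if_neg (Ne.symm hp.1), if_pos rfl, hzero]
      · rw [if_neg (ne_of_mem_of_not_mem hj hp.2), if_neg (ne_of_mem_of_not_mem hj hq), hLs j hj]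
    · rw [Finset.mem_insert, not_or] at hj
      rw [LinearEquiv.trans_apply, planeEquiv_apply, if_neg hjp, if_neg hj.1, hLw j hj.2 hjp]

/-- The ideal generated by the coordinates of a vector is invariant under automorphisms. -/
theorem LinearEquiv.span_range_apply_eq {R ι : Type*} [CommRing R] [Finite ι]
    (L : (ι → R) ≃ₗ[R] (ι → R)) (w : ι → R) :
    Ideal.span (Set.range (L w)) = Ideal.span (Set.range w) := by
  have key : ∀ (M : (ι → R) ≃ₗ[R] (ι → R)) (v : ι → R),
      Ideal.span (Set.range (M v)) ≤ Ideal.span (Set.range v) := by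
    intro M v
    rw [Ideal.span_le]
    rintro _ ⟨i, rfl⟩
    exact Ideal.map_pi _ v (fun j => Ideal.subset_span (Set.mem_range_self j)) M.toLinearMap i
  refine le_antisymm (key L w) ?_
  simpa using key L.symm (L w)

theorem Ideal.span_range_pi_single {R ι : Type*} [CommRing R] [DecidableEq ι] (p : ι) (c : R) :
    Ideal.span (Set.range (Pi.single p c : ι → R)) = Ideal.span {c} := by
  apply le_antisymm
  · rw [Ideal.span_le]
    rintro _ ⟨i, rfl⟩
    rcases eq_or_ne i p with rfl | hi
    · simp
    · simp [hi]
  · rw [Ideal.span_singleton_le_iff_mem]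
    exact Ideal.subset_span ⟨p, by simp⟩

/-- A vector vanishing at `u` can be moved to any generator of its content ideal, placed at the
coordinate `p`, by an automorphism fixing the basis vector at `u`. -/
theorem exists_linearEquiv_eq_single {R ι : Type*} [CommRing R] [IsDomain R] [IsBezout R]
    [Fintype ι] [DecidableEq ι] {u p : ι} (hup : u ≠ p) (w : ι → R) (hw : w u = 0) (r : R)
    (hr : Ideal.span (Set.range w) = Ideal.span {r}) :
    ∃ L : (ι → R) ≃ₗ[R] (ι → R), L (Pi.single u 1) = Pi.single u 1 ∧ L w = Pi.single p r := by
  obtain ⟨L, hLu, hLs, hLw⟩ := exists_linearEquiv_eq_zero_on hup w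
    ((Finset.univ.erase p).erase u) (by simp) (by simp)
  have hsingle : L w = Pi.single p (L w p) := by
    ext j
    rcases eq_or_ne j p with rfl | hjp
    · simp
    rw [Pi.single_eq_of_ne hjp]
    rcases eq_or_ne j u with rfl | hju
    · rw [hLw j (by simp) hjp, hw]
    · exact hLs j (by simp [hjp, hju])
  have hassoc : Associated (L w p) r := by
    rw [← Ideal.span_singleton_eq_span_singleton, ← Ideal.span_range_pi_single p (L w p),
      ← hsingle, L.span_range_apply_eq, hr]
  obtain ⟨c, hc⟩ := hassoc
  let S : (ι → R) ≃ₗ[R] (ι → R) :=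
    LinearEquiv.piCongrRight fun j => LinearEquiv.smulOfUnit (if j = p then c else 1)
  have hS : ∀ v j, S v j = (if j = p then c else 1 : Rˣ) • v j := fun _ _ => rfl
  refine ⟨L.trans S, ?_, ?_⟩
  · ext j
    rw [LinearEquiv.trans_apply, hLu, hS]
    rcases eq_or_ne j p with rfl | hjp
    · simp [hup.symm]
    · simp [hjp]
  · ext j
    rw [LinearEquiv.trans_apply, hsingle, hS]
    rcases eq_or_ne j p with rfl | hjp
    · simp [Units.smul_def, ← hc, mul_comm]
    · simp [hjp]

open Matrix in
/-- A matrix is similar to one whose row `u` is supported on `{u, p}`, with any prescribed generator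
of the ideal of off-diagonal entries at `p`. -/
theorem Matrix.exists_conj_row_eq {R ι : Type*} [CommRing R] [IsDomain R] [IsBezout R]
    [Fintype ι] [DecidableEq ι] (A : Matrix ι ι R) {u p : ι} (hup : u ≠ p) (r : R)
    (hr : Ideal.span {x : R | ∃ j, j ≠ u ∧ x = A u j} = Ideal.span {r}) :
    ∃ g : (Matrix ι ι R)ˣ, ((g : Matrix ι ι R) * A * (↑g⁻¹ : Matrix ι ι R)) u =
      Pi.single p r + Pi.single u (A u u) := by
  have hspan : Ideal.span (Set.range (Function.update (A u) u 0)) = Ideal.span {r} := by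
    rw [← hr]
    apply le_antisymm <;> rw [Ideal.span_le]
    · rintro _ ⟨j, rfl⟩
      rcases eq_or_ne j u with rfl | hj
      · simp
      · rw [Function.update_of_ne hj]
        exact Ideal.subset_span ⟨j, hj, rfl⟩
    · rintro _ ⟨j, hj, rfl⟩
      exact Ideal.subset_span ⟨j, Function.update_of_ne hj _ _⟩
  obtain ⟨L, hLu, hLw⟩ := exists_linearEquiv_eq_single hup _ (by simp) r hspan
  have hrow : A u = Function.update (A u) u 0 + A u u • Pi.single u 1 := by
    ext j
    rcases eq_or_ne j u with rfl | hj
    · simp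
    · simp [hj]
  have hLA : L (A u) = Pi.single p r + Pi.single u (A u u) := by
    rw [hrow, map_add, map_smul, hLu, hLw, ← hrow, ← Pi.single_smul, smul_eq_mul, mul_one]
  let M : Matrix ι ι R := (LinearMap.toMatrix' L.toLinearMap)ᵀ
  let N : Matrix ι ι R := (LinearMap.toMatrix' L.symm.toLinearMap)ᵀ
  have hM : ∀ v, v ᵥ* M = L v := fun v => by
    rw [Matrix.vecMul_transpose, LinearMap.toMatrix'_mulVec]; rfl
  have hN : ∀ v, v ᵥ* N = L.symm v := fun v => by
    rw [Matrix.vecMul_transpose, LinearMap.toMatrix'_mulVec]; rfl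
  have hNM : N * M = 1 := by
    rw [← Matrix.transpose_mul, ← LinearMap.toMatrix'_comp]
    simp
  have hMN : M * N = 1 := by
    rw [← Matrix.transpose_mul, ← LinearMap.toMatrix'_comp]
    simp
  refine ⟨⟨N, M, hNM, hMN⟩, ?_⟩
  change (N * A * M) u = _
  have hNu : N.row u = Pi.single u 1 := by
    rw [← Matrix.single_one_vecMul, hN, LinearEquiv.symm_apply_eq, hLu]
  rw [Matrix.mul_apply_eq_vecMul, Matrix.mul_apply_eq_vecMul, hM]
  change L (N.row u ᵥ* A) = _
  rw [hNu, Matrix.single_one_vecMul]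
  exact hLA

/-- **Lemma (row normalisation).** Let `R` be a PID, `A` an `n × n` matrix (`n ≥ 3`,
encoded as `n + 3`), `u` a row index, and `r` a generator of the ideal generated by the
off-diagonal entries of row `u`. Then `A` is similar to a matrix `B` whose row `u` has all
off-diagonal entries zero except one, equal to `r`: if `u = 0` then `B 0 1 = r` and
`B 0 j = 0` for `j ≥ 2`; if `u ≠ 0` then `B u 0 = r` and `B u j = 0` for `j ∉ {0, u}`. -/
theorem similar_row_normal_form {R : Type*} [CommRing R] [IsDomain R]
    [IsPrincipalIdealRing R] {n : ℕ}
    (A : Matrix (Fin (n + 3)) (Fin (n + 3)) R) (u : Fin (n + 3)) (r : R)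
    (hr : Ideal.span {x : R | ∃ j : Fin (n + 3), j ≠ u ∧ x = A u j} = Ideal.span {r}) :
    ∃ B : Matrix (Fin (n + 3)) (Fin (n + 3)) R,
      (∃ g : (Matrix (Fin (n + 3)) (Fin (n + 3)) R)ˣ,
        B = (g : Matrix (Fin (n + 3)) (Fin (n + 3)) R) * A * (↑g⁻¹ : Matrix (Fin (n + 3)) (Fin (n + 3)) R)) ∧
      (u = 0 → B 0 1 = r ∧ ∀ j : Fin (n + 3), 2 ≤ (j : ℕ) → B 0 j = 0) ∧
      (u ≠ 0 → B u 0 = r ∧ ∀ j : Fin (n + 3), j ≠ 0 → j ≠ u → B u j = 0) := by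
  rcases eq_or_ne u 0 with rfl | hu
  · obtain ⟨g, hg⟩ := A.exists_conj_row_eq (p := 1) (by simp) r hr
    refine ⟨_, ⟨g, rfl⟩, fun _ => ⟨by rw [hg]; simp, fun j hj => ?_⟩, fun h => absurd rfl h⟩
    have h0 : j ≠ 0 := by rintro rfl; simp at hj
    have h1 : j ≠ 1 := by rintro rfl; simp at hj
    rw [hg]
    simp [h0, h1]
  · obtain ⟨g, hg⟩ := A.exists_conj_row_eq hu r hr
    exact ⟨_, ⟨g, rfl⟩, fun h => absurd h hu, fun _ =>
      ⟨by rw [hg]; simp [hu.symm], fun j h0 hju => by rw [hg]; simp [h0, hju]⟩⟩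
end

section
/- Let R be a principal ideal domain and let α, β ∈ R generate the unit ideal. Suppose p is a maximal ideal of R whose residue field R/p has at least 3 elements. Then for every finite set S of maximal ideals of R with p ∉ S, there exists t ∈ R such that t ∉ p, t ∈ q for all q ∈ S, and αt + β ∉ p. -/
theorem Ideal.exists_notMem_forall_mem_of_isMaximal {R : Type*} [CommRing R] (p : Ideal R)
    (hp : p.IsPrime) (S : Finset (Ideal R)) (hS : ∀ q ∈ S, q.IsMaximal) (hpS : p ∉ S) :
    ∃ s : R, s ∉ p ∧ ∀ q ∈ S, s ∈ q := by
  have h : ¬ S.inf id ≤ p := by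
    rw [hp.inf_le']
    rintro ⟨q, hq, hqp⟩
    exact hpS ((hS q hq).eq_of_le hp.ne_top hqp ▸ hq)
  obtain ⟨s, hs, hsp⟩ := SetLike.not_le_iff_exists.mp h
  exact ⟨s, hsp, fun q hq => Finset.inf_le (f := id) hq hs⟩

/-- An affine function `a * u + b` on a field with `(a, b) ≠ 0` is nonzero at some nonzero point
as soon as the field has three elements. -/
theorem exists_ne_zero_affine_ne_zero {K : Type*} [Field K] {a b : K} (hab : a ≠ 0 ∨ b ≠ 0)
    (h : ∃ x y z : K, x ≠ y ∧ x ≠ z ∧ y ≠ z) : ∃ u : K, u ≠ 0 ∧ a * u + b ≠ 0 := by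
  obtain ⟨x, y, z, hxy, hxz, hyz⟩ := h
  by_contra! hc
  have nonzero_unique (u v : K) (hu : u ≠ 0) (hv : v ≠ 0) : u = v := by
    have hmul : a * (u - v) = 0 := by linear_combination hc u hu - hc v hv
    refine sub_eq_zero.mp ((mul_eq_zero.mp hmul).resolve_left fun ha => ?_)
    have hb : b = 0 := by simpa [ha] using hc u hu
    exact hab.elim (· ha) (· hb)
  by_cases hx : x = 0
  · exact hyz (nonzero_unique y z (hx ▸ hxy.symm) (hx ▸ hxz.symm))
  · have hy : y = 0 := by_contra fun hy => hxy (nonzero_unique x y hx hy)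
    exact hxz (nonzero_unique x z hx (hy ▸ hyz.symm))

/-- **Lemma.** Let `R` be a PID and `α, β ∈ R` coprime. Let `p` be a maximal ideal whose
residue field `R/p` has at least 3 elements. Then for every finite set `S` of maximal
ideals with `p ∉ S` there is `t ∈ R` with `t ∉ p`, `t ∈ q` for all `q ∈ S`, and
`α * t + β ∉ p`. -/
theorem exists_t_avoiding_prime {R : Type*} [CommRing R] [IsDomain R]
    [IsPrincipalIdealRing R] {α β : R} (hab : IsCoprime α β)
    (p : Ideal R) (hp : p.IsMaximal)
    (hcard : ∃ x y z : R ⧸ p, x ≠ y ∧ x ≠ z ∧ y ≠ z)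
    (S : Finset (Ideal R)) (hS : ∀ q ∈ S, q.IsMaximal) (hpS : p ∉ S) :
    ∃ t : R, t ∉ p ∧ (∀ q ∈ S, t ∈ q) ∧ α * t + β ∉ p := by
  obtain ⟨s, hsp, hsS⟩ := p.exists_notMem_forall_mem_of_isMaximal hp.isPrime S hS hpS
  let := Ideal.Quotient.field p
  let π := Ideal.Quotient.mk p
  have hs : π s ≠ 0 := fun h => hsp (Ideal.Quotient.eq_zero_iff_mem.mp h)
  have hαβ : π α * π s ≠ 0 ∨ π β ≠ 0 :=
    (hab.map π).ne_zero_or_ne_zero.imp_left (mul_ne_zero · hs)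
  obtain ⟨u, hu, hαu⟩ := exists_ne_zero_affine_ne_zero hαβ hcard
  obtain ⟨u, rfl⟩ := Ideal.Quotient.mk_surjective u
  refine ⟨s * u, fun h => ?_, fun q hq => q.mul_mem_right u (hsS q hq), fun h => hαu ?_⟩
  · exact (hp.isPrime.mem_or_mem h).elim hsp
      fun h => hu (Ideal.Quotient.eq_zero_iff_mem.mpr h)
  · simpa [π, mul_assoc] using Ideal.Quotient.eq_zero_iff_mem.mpr h
end
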